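/- Let K be a field and let 𝐟_1, …, 𝐟_k : ℕ → ℕ^m be functions each of whose coordinates is given by a polynomial with integer coefficients. For each n, let φ_n : K[x_1, …, x_k] → K[y_1, …, y_m] be the K-algebra homomorphism sending x_i to the monomial y^{𝐟_i(n)} (the monomial whose exponent vector is 𝐟_i(n)), and let I_n = ker(φ_n) be the associated toric ideal. Then the function sending n to the minimal cardinality of a finite set generating I_n as an ideal is eventually quasi-polynomial. -/

import Mathlib

/-- A function `c : ℕ → ℚ` is eventually periodic if there are `N` and `p ≥ 1`
with `c (n + p) = c n` for all `n ≥ N`. -/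
def EvPeriodic (c : ℕ → ℚ) : Prop :=
  ∃ N p : ℕ, 1 ≤ p ∧ ∀ n, N ≤ n → c (n + p) = c n

/-- A function `g : ℕ → ℤ` is eventually quasi-polynomial if
`g n = Σ_{i=0}^d c_i(n)·n^i` for eventually periodic `c_0, …, c_d : ℕ → ℚ`. -/
def IsEQP (g : ℕ → ℤ) : Prop :=
  ∃ (d : ℕ) (c : ℕ → ℕ → ℚ), (∀ i, i ≤ d → EvPeriodic (c i)) ∧
    ∀ n : ℕ, (g n : ℚ) = ∑ i ∈ Finset.range (d + 1), c i n * (n : ℚ) ^ i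

/-- The shift operator on integer sequences. -/
def seqShift : Module.End ℤ (ℕ → ℤ) := LinearMap.funLeft ℤ ℤ (· + 1)

theorem seqShift_pow_apply (c : ℕ) (g : ℕ → ℤ) (n : ℕ) : (seqShift ^ c) g n = g (n + c) := by
  induction c generalizing g with
  | zero => simp
  | succ c ih =>
    rw [pow_succ, Module.End.mul_apply, ih]
    simp [seqShift, LinearMap.funLeft_apply, add_assoc]

/-- Integer sequences killed by `X ^ N * (X ^ p - 1) ^ d`, where `X` acts by the shift. -/
def IsShiftQuasi (g : ℕ → ℤ) : Prop :=
  ∃ p d N : ℕ, 0 < p ∧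
    Polynomial.aeval seqShift (Polynomial.X ^ N * (Polynomial.X ^ p - 1) ^ d : Polynomial ℤ) g = 0

open Polynomial in
theorem aeval_seqShift_eq_zero_of_dvd {P Q : ℤ[X]} (h : P ∣ Q) {g : ℕ → ℤ}
    (hg : aeval seqShift P g = 0) : aeval seqShift Q g = 0 := by
  obtain ⟨R, rfl⟩ := h
  rw [mul_comm, map_mul, Module.End.mul_apply, hg, map_zero]

open Polynomial in
theorem X_pow_sub_one_dvd {p q : ℕ} (h : p ∣ q) : (X ^ p - 1 : ℤ[X]) ∣ X ^ q - 1 := by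
  obtain ⟨r, rfl⟩ := h
  rw [pow_mul]
  simpa using sub_dvd_pow_sub_pow (X ^ p : ℤ[X]) 1 r

open Polynomial in
theorem aeval_seqShift_mono {p q d e N M : ℕ} (hp : p ∣ q) (hd : d ≤ e) (hN : N ≤ M) {g : ℕ → ℤ}
    (hg : aeval seqShift (X ^ N * (X ^ p - 1) ^ d : ℤ[X]) g = 0) :
    aeval seqShift (X ^ M * (X ^ q - 1) ^ e : ℤ[X]) g = 0 :=
  aeval_seqShift_eq_zero_of_dvd (mul_dvd_mul (pow_dvd_pow _ hN)
    ((pow_dvd_pow_of_dvd (X_pow_sub_one_dvd hp) d).trans (pow_dvd_pow _ hd))) hg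

namespace IsShiftQuasi

theorem zero : IsShiftQuasi (fun _ => 0) := ⟨1, 0, 0, one_pos, map_zero _⟩

theorem add {g h : ℕ → ℤ} (hg : IsShiftQuasi g) (hh : IsShiftQuasi h) :
    IsShiftQuasi (fun n => g n + h n) := by
  obtain ⟨p, d, N, hp, hg⟩ := hg
  obtain ⟨q, e, M, hq, hh⟩ := hh
  refine ⟨p * q, max d e, max N M, Nat.mul_pos hp hq, ?_⟩
  rw [show (fun n => g n + h n) = g + h from rfl, map_add,
    aeval_seqShift_mono (dvd_mul_right p q) (le_max_left d e) (le_max_left N M) hg,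
    aeval_seqShift_mono (dvd_mul_left q p) (le_max_right d e) (le_max_right N M) hh, add_zero]

theorem neg {g : ℕ → ℤ} (hg : IsShiftQuasi g) : IsShiftQuasi (fun n => - g n) := by
  obtain ⟨p, d, N, hp, hg⟩ := hg
  exact ⟨p, d, N, hp, by rw [show (fun n => - g n) = - g from rfl, map_neg, hg, neg_zero]⟩

theorem sub {g h : ℕ → ℤ} (hg : IsShiftQuasi g) (hh : IsShiftQuasi h) :
    IsShiftQuasi (fun n => g n - h n) := by
  simpa only [sub_eq_add_neg] using hg.add hh.neg

open Polynomial in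
/-- Being killed by `X ^ N * (X ^ p - 1) ^ d` can be tested after applying a shift. -/
theorem of_shift {g h : ℕ → ℤ} (c : ℕ) (hh : IsShiftQuasi h) (H : ∀ n, g (n + c) = h n) :
    IsShiftQuasi g := by
  obtain ⟨p, d, N, hp, hh⟩ := hh
  refine ⟨p, d, N + c, hp, ?_⟩
  have : (aeval seqShift (X ^ c : ℤ[X])) g = h := by
    ext n
    simp [seqShift_pow_apply, H]
  rw [pow_add, mul_right_comm, map_mul, Module.End.mul_apply, this, hh]

open Polynomial in
theorem shift {g : ℕ → ℤ} (c : ℕ) (hg : IsShiftQuasi g) : IsShiftQuasi (fun n => g (n + c)) := by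
  obtain ⟨p, d, N, hp, hg⟩ := hg
  refine ⟨p, d, N, hp, ?_⟩
  have : (aeval seqShift (X ^ c : ℤ[X])) g = fun n => g (n + c) := by
    ext n
    simp [seqShift_pow_apply]
  rw [← this, ← Module.End.mul_apply, ← map_mul, mul_comm, map_mul, Module.End.mul_apply, hg,
    map_zero]

theorem congr {g h : ℕ → ℤ} (hh : IsShiftQuasi h) (N : ℕ) (H : ∀ n, N ≤ n → g n = h n) :
    IsShiftQuasi g :=
  of_shift N (hh.shift N) fun _ => H _ (Nat.le_add_left _ _)

theorem const (c : ℤ) : IsShiftQuasi (fun _ => c) := by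
  refine ⟨1, 1, 0, one_pos, ?_⟩
  ext n
  simp [seqShift, LinearMap.funLeft_apply]

open Polynomial in
/-- Solutions of the difference equation `h (n + w) - h n = g n`. -/
theorem of_diff {g h : ℕ → ℤ} {w : ℕ} (hw : 0 < w) (hg : IsShiftQuasi g)
    (H : ∀ n, h (n + w) = h n + g n) : IsShiftQuasi h := by
  obtain ⟨p, d, N, hp, hg⟩ := hg
  have h1 : (aeval seqShift (X ^ w - 1 : ℤ[X])) h = g := by
    ext n
    simp [seqShift_pow_apply, H]
  have h2 : aeval seqShift ((X ^ N * (X ^ p - 1) ^ d) * (X ^ w - 1) : ℤ[X]) h = 0 := by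
    rw [map_mul, Module.End.mul_apply, h1, hg]
  refine ⟨p * w, d + 1, N, Nat.mul_pos hp hw, aeval_seqShift_eq_zero_of_dvd ?_ h2⟩
  rw [pow_succ, ← mul_assoc]
  exact mul_dvd_mul (mul_dvd_mul dvd_rfl
    (pow_dvd_pow_of_dvd (X_pow_sub_one_dvd (dvd_mul_right p w)) d))
    (X_pow_sub_one_dvd (dvd_mul_left w p))

open Polynomial in
/-- Newton's formula along a residue class. -/
theorem exists_polynomial {g : ℕ → ℤ} {p d N : ℕ} (hp : 0 < p)
    (hg : aeval seqShift (X ^ N * (X ^ p - 1) ^ d : ℤ[X]) g = 0) (r : ℕ) (hr : N ≤ r) :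
    ∃ P : ℚ[X], P.natDegree ≤ d ∧ ∀ q : ℕ, (g (r + p * q) : ℚ) = P.eval ((r + p * q : ℕ) : ℚ) := by
  have hz : ∀ k, d ≤ k → (fwdDiff p)^[k] g r = 0 := by
    intro k hk
    have h1 := aeval_seqShift_mono (dvd_refl p) hk hr hg
    have h2 : (aeval seqShift ((X ^ p - 1) ^ k : ℤ[X])) g = (fwdDiff p)^[k] g := by
      have : ∀ f, (seqShift ^ p - 1) f = fwdDiff p f := by
        intro f
        ext n
        simp [seqShift_pow_apply, fwdDiff]
      simp only [map_pow, map_sub, aeval_X, map_one, Module.End.pow_apply]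
      congr 2
      ext1 f
      exact this f
    have h3 := congrFun h1 0
    rw [map_mul, Module.End.mul_apply, h2] at h3
    simpa [seqShift_pow_apply] using h3
  have hp' : (p : ℚ) ≠ 0 := by positivity
  let L : ℚ[X] := C (p : ℚ)⁻¹ * (X - C (r : ℚ))
  have hL : L.natDegree ≤ 1 := by
    exact (natDegree_C_mul_le _ _).trans (natDegree_X_sub_C_le _)
  refine ⟨∑ k ∈ Finset.range d, C ((((fwdDiff p)^[k] g r : ℤ) : ℚ) / k.factorial) *
    (descPochhammer ℚ k).comp L, ?_, ?_⟩
  · refine natDegree_sum_le_of_forall_le _ _ fun k hk => ?_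
    refine (natDegree_C_mul_le _ _).trans (natDegree_comp_le.trans ?_)
    rw [descPochhammer_natDegree]
    have := Finset.mem_range.1 hk
    nlinarith
  · intro q
    have h := shift_eq_sum_fwdDiff_iter (h := p) g q r
    rw [smul_eq_mul, mul_comm] at h
    have h' : g (r + p * q) = ∑ k ∈ Finset.range d, q.choose k • (fwdDiff p)^[k] g r := by
      rw [h]
      rcases le_total d (q + 1) with h1 | h1
      · symm
        refine Finset.sum_subset (Finset.range_subset_range.2 h1) fun k _ hk => ?_
        rw [hz k (by simpa using hk), smul_zero]
      · refine Finset.sum_subset (Finset.range_subset_range.2 h1) fun k _ hk => ?_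
        rw [Nat.choose_eq_zero_of_lt (by simpa using hk), zero_smul]
    rw [h', eval_finsetSum]
    push_cast [nsmul_eq_mul]
    refine Finset.sum_congr rfl fun k _ => ?_
    have hLq : L.eval ((r : ℚ) + p * q) = q := by
      simp only [L, eval_mul, eval_C, eval_sub, eval_X]
      field_simp
      ring
    rw [eval_mul, eval_C, eval_comp, hLq, descPochhammer_eval_eq_descFactorial,
      Nat.descFactorial_eq_factorial_mul_choose]
    push_cast
    field_simp

theorem isEQP {g : ℕ → ℤ} (hg : IsShiftQuasi g) : IsEQP g := by
  obtain ⟨p, d, N, hp, hg⟩ := hg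
  choose P hP hPg using fun r : {r : ℕ // N ≤ r} => exists_polynomial hp hg r.1 r.2
  let rep : ℕ → {r : ℕ // N ≤ r} := fun n => ⟨N + (n - N) % p, Nat.le_add_right _ _⟩
  refine ⟨d, fun i n => if N ≤ n then (P (rep n)).coeff i else if i = 0 then (g n : ℚ) else 0,
    fun i _ => ⟨N, p, hp, fun n hn => ?_⟩, fun n => ?_⟩
  · have : rep (n + p) = rep n := by
      simp only [rep, Subtype.mk.injEq, add_right_inj]
      rw [Nat.sub_add_comm hn, Nat.add_mod_right]
    simp only [hn, le_add_right hn, if_true, this]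
  · by_cases hn : N ≤ n
    · simp only [hn, if_true]
      have h1 : n = (rep n).1 + p * ((n - N) / p) := by
        have := Nat.mod_add_div (n - N) p
        simp only [rep]
        omega
      conv_lhs => rw [h1, hPg, ← h1]
      exact Polynomial.eval_eq_sum_range' (Nat.lt_succ_of_le (hP _)) _
    · simp only [hn, if_false]
      rw [Finset.sum_eq_single 0] <;> simp +contextual

end IsShiftQuasi

/-- The number of elements of `S` of weight `n`. -/
noncomputable def sliceCount {X : Type*} (S : Set X) (wt : X → ℕ) (n : ℕ) : ℤ :=
  ({x ∈ S | wt x = n}.ncard : ℤ)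

/-- All sets of elements of `S` of a given weight are finite. -/
def FiniteSlices {X : Type*} (S : Set X) (wt : X → ℕ) : Prop := ∀ n, {x ∈ S | wt x = n}.Finite

theorem FiniteSlices.mono {X : Type*} {S T : Set X} {wt : X → ℕ} (h : FiniteSlices T wt)
    (hST : S ⊆ T) : FiniteSlices S wt :=
  fun n => (h n).subset fun _ hx => ⟨hST hx.1, hx.2⟩

theorem FiniteSlices.image_iff {X Y : Type*} {S : Set X} {f : X → Y} (hf : Set.InjOn f S)
    {wt : Y → ℕ} : FiniteSlices (f '' S) wt ↔ FiniteSlices S (wt ∘ f) := by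
  refine forall_congr' fun n => ?_
  have : {y ∈ f '' S | wt y = n} = f '' {x ∈ S | (wt ∘ f) x = n} := by
    ext y
    constructor
    · rintro ⟨⟨x, hx, rfl⟩, h⟩
      exact ⟨x, ⟨hx, h⟩, rfl⟩
    · rintro ⟨x, ⟨hx, h⟩, rfl⟩
      exact ⟨⟨x, hx, rfl⟩, h⟩
  rw [this, Set.finite_image_iff (hf.mono fun x hx => hx.1)]

theorem sliceCount_image {X Y : Type*} {S : Set X} {f : X → Y} (hf : Set.InjOn f S) (wt : Y → ℕ) :
    sliceCount (f '' S) wt = sliceCount S (wt ∘ f) := by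
  ext n
  have : {y ∈ f '' S | wt y = n} = f '' {x ∈ S | (wt ∘ f) x = n} := by
    ext y
    constructor
    · rintro ⟨⟨x, hx, rfl⟩, h⟩
      exact ⟨x, ⟨hx, h⟩, rfl⟩
    · rintro ⟨x, ⟨hx, h⟩, rfl⟩
      exact ⟨⟨x, hx, rfl⟩, h⟩
  rw [sliceCount, sliceCount, this, (hf.mono fun x hx => hx.1).ncard_image]

theorem sliceCount_empty {X : Type*} (wt : X → ℕ) : sliceCount ∅ wt = fun _ => 0 := by
  ext n
  simp [sliceCount]

theorem sliceCount_union_add_inter {X : Type*} {S T : Set X} {wt : X → ℕ} (hS : FiniteSlices S wt)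
    (hT : FiniteSlices T wt) (n : ℕ) :
    sliceCount (S ∪ T) wt n + sliceCount (S ∩ T) wt n = sliceCount S wt n + sliceCount T wt n := by
  have h := Set.ncard_union_add_ncard_inter _ _ (hS n) (hT n)
  have h1 : {x ∈ S | wt x = n} ∪ {x ∈ T | wt x = n} = {x ∈ S ∪ T | wt x = n} := by
    ext x
    simp only [Set.mem_union, Set.mem_ofPred]
    tauto
  have h2 : {x ∈ S | wt x = n} ∩ {x ∈ T | wt x = n} = {x ∈ S ∩ T | wt x = n} := by
    ext x
    simp only [Set.mem_inter_iff, Set.mem_ofPred]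
    tauto
  rw [h1, h2] at h
  unfold sliceCount
  exact_mod_cast h

theorem sliceCount_union {X : Type*} {S T : Set X} {wt : X → ℕ} (hS : FiniteSlices S wt)
    (hT : FiniteSlices T wt) (hST : Disjoint S T) (n : ℕ) :
    sliceCount (S ∪ T) wt n = sliceCount S wt n + sliceCount T wt n := by
  rw [← sliceCount_union_add_inter hS hT, hST.inter_eq, sliceCount_empty, add_zero]

theorem IsShiftQuasi.sliceCount_const_add {X : Type*} {S : Set X} {wt : X → ℕ}
    (h : IsShiftQuasi (sliceCount S wt)) (c : ℕ) :
    IsShiftQuasi (sliceCount S fun x => c + wt x) := by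
  refine .of_shift c h fun n => ?_
  simp only [sliceCount, add_comm n c, add_right_inj]

theorem FiniteSlices.of_const_add {X : Type*} {S : Set X} {wt : X → ℕ} {c : ℕ}
    (h : FiniteSlices S fun x => c + wt x) : FiniteSlices S wt := by
  intro n
  simpa using h (c + n)

/-- In `ℕ ^ s` every set has finitely many minimal elements, which bound it from below. -/
theorem exists_finite_minimal {ι : Type*} [Finite ι] (C : Set (ι → ℕ)) :
    {m | Minimal (· ∈ C) m}.Finite ∧ ∀ x ∈ C, ∃ m ≤ x, Minimal (· ∈ C) m := by
  refine ⟨WellQuasiOrderedLE.finite_of_isAntichain (setOfPred_minimal_antichain _), fun x hx => ?_⟩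
  obtain ⟨m, hm, h⟩ := exists_minimal_le_of_wellFoundedLT (· ∈ C) x hx
  exact ⟨m, hm, h⟩

theorem IsLowerSet.isShiftQuasi_sliceCount {s : ℕ} {U : Set (Fin s → ℕ)} (hU : IsLowerSet U)
    (w : Fin s → ℕ) (hfin : FiniteSlices U fun x => ∑ i, x i * w i) :
    IsShiftQuasi (sliceCount U fun x => ∑ i, x i * w i) := by
  induction s with
  | zero =>
    refine IsShiftQuasi.zero.congr 1 fun n hn => ?_
    have : n ≠ 0 := by omega
    simp [sliceCount, this.symm]
  | succ s ih =>
    set wt : (Fin (s + 1) → ℕ) → ℕ := fun x => ∑ i, x i * w i with hwt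
    let V : ℕ → Set (Fin s → ℕ) := fun t => {y | (Fin.cons t y : Fin (s + 1) → ℕ) ∈ U}
    let U' : ℕ → Set (Fin (s + 1) → ℕ) := fun t => {x ∈ U | t ≤ x 0}
    let cn : ℕ → (Fin s → ℕ) → (Fin (s + 1) → ℕ) := fun t y => Fin.cons t y
    have hcons : ∀ t, Function.Injective (cn t) :=
      fun t => Fin.cons_right_injective (α := fun _ => ℕ) t
    have hV : ∀ t, IsShiftQuasi (sliceCount (cn t '' V t) wt) := by
      intro t
      have hf : FiniteSlices (cn t '' V t) wt :=
        hfin.mono (by rintro _ ⟨y, hy, rfl⟩; exact hy)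
      rw [FiniteSlices.image_iff (hcons t).injOn] at hf
      rw [sliceCount_image (hcons t).injOn]
      have hc : wt ∘ cn t =
          fun y => t * w 0 + ∑ i, y i * w i.succ := by
        ext y
        simp [hwt, cn, Fin.sum_univ_succ]
      rw [hc] at hf ⊢
      refine IsShiftQuasi.sliceCount_const_add (ih ?_ _ hf.of_const_add) _
      intro y z hzy hy
      exact hU (by simpa [Pi.le_def, Fin.forall_fin_succ] using hzy) hy
    have hstep : ∀ t n, sliceCount (U' t) wt n =
        sliceCount (cn t '' V t) wt n + sliceCount (U' (t + 1)) wt n := by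
      intro t n
      have hEq : U' t = cn t '' V t ∪ U' (t + 1) := by
        ext x
        constructor
        · rintro ⟨hx, ht⟩
          rcases ht.eq_or_lt with h | h
          · refine .inl ⟨Fin.tail x, ?_, ?_⟩
            · change Fin.cons t (Fin.tail x) ∈ U
              rwa [h, Fin.cons_self_tail]
            · change Fin.cons t (Fin.tail x) = x
              rw [h, Fin.cons_self_tail]
          · exact .inr ⟨hx, h⟩
        · rintro (⟨y, hy, rfl⟩ | ⟨hx, ht⟩)
          · exact ⟨hy, by simp [cn]⟩
          · exact ⟨hx, by omega⟩
      rw [hEq]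
      refine sliceCount_union (hfin.mono ?_) (hfin.mono fun x hx => hx.1) ?_ n
      · rintro _ ⟨y, hy, rfl⟩
        exact hy
      · rw [Set.disjoint_left]
        rintro _ ⟨y, hy, rfl⟩ ⟨_, h⟩
        simp [cn] at h
    obtain ⟨T, hT⟩ : ∃ T, ∀ t, T ≤ t → ∀ y, y ∈ V T → y ∈ V t := by
      obtain ⟨hf, hm⟩ := exists_finite_minimal Uᶜ
      obtain ⟨T, hT⟩ := (hf.image (fun m => m 0)).bddAbove
      refine ⟨T, fun t ht y hy => ?_⟩
      by_contra hcon
      obtain ⟨m, hmx, hmin⟩ := hm (Fin.cons t y) hcon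
      refine hmin.prop (hU ?_ hy)
      have := hT ⟨m, hmin, rfl⟩
      intro i
      refine Fin.cases ?_ (fun i => ?_) i
      · simpa using this
      · simpa using hmx i.succ
    have hmem : ∀ x : Fin (s + 1) → ℕ, T ≤ x 0 → (x ∈ U ↔ Fin.tail x ∈ V T) := by
      intro x hx
      constructor
      · intro h
        refine hU ?_ h
        intro i
        refine Fin.cases ?_ (fun i => ?_) i
        · simpa using hx
        · simp [Fin.tail]
      · intro h
        have := hT _ hx _ h
        change Fin.cons (x 0) (Fin.tail x) ∈ U at this
        rwa [Fin.cons_self_tail] at this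
    have htail : IsShiftQuasi (sliceCount (U' T) wt) := by
      rcases Nat.eq_zero_or_pos (w 0) with h0 | h0
      · have : U' T = ∅ := by
          rw [Set.eq_empty_iff_forall_notMem]
          rintro x ⟨hx, hxT⟩
          have hx' := (hmem x hxT).1 hx
          refine Set.infinite_of_injective_forall_mem
            (f := fun t : ℕ => (Fin.cons (T + t) (Fin.tail x) : Fin (s + 1) → ℕ)) ?_ ?_
            (hfin (wt x))
          · intro a b hab
            simpa using congrFun hab 0
          · intro t
            refine ⟨hT _ (Nat.le_add_right _ _) _ hx', ?_⟩
            simp [hwt, Fin.sum_univ_succ, h0, Fin.tail]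
        rw [this, sliceCount_empty]
        exact .zero
      · refine .of_diff h0 ((hV T).shift (w 0)) fun n => ?_
        rw [hstep, add_comm, add_left_inj]
        let e : (Fin (s + 1) → ℕ) → (Fin (s + 1) → ℕ) := fun x => x + Pi.single 0 1
        have he : Function.Injective e := add_left_injective _
        have hEq : U' (T + 1) = e '' U' T := by
          ext x
          constructor
          · rintro ⟨hx, hxT⟩
            refine ⟨x - Pi.single 0 1, ⟨hU tsub_le_self hx, ?_⟩, ?_⟩
            · simp
              omega
            · refine tsub_add_cancel_of_le fun i => ?_
              refine Fin.cases ?_ (fun i => ?_) i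
              · simp
                omega
              · simp
          · rintro ⟨x, ⟨hx, hxT⟩, rfl⟩
            refine ⟨?_, by simpa [e] using hxT⟩
            rw [hmem _ (by simp [e]; omega)]
            rw [hmem _ hxT] at hx
            convert hx using 1
            ext i
            simp [e, Fin.tail]
        rw [hEq, sliceCount_image he.injOn]
        have : wt ∘ e = fun x => w 0 + wt x := by
          ext x
          simp [hwt, e, Fin.sum_univ_succ]
          ring
        rw [this]
        simp only [sliceCount, add_comm n, add_right_inj]
    have hall : ∀ j, j ≤ T → IsShiftQuasi (sliceCount (U' (T - j)) wt) := by
      intro j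
      induction j with
      | zero => exact fun _ => htail
      | succ j ihj =>
        intro hj
        have h1 := ihj (by omega)
        rw [funext (hstep (T - (j + 1)))]
        rw [show T - (j + 1) + 1 = T - j by omega]
        exact (hV _).add h1
    have := hall T le_rfl
    rwa [Nat.sub_self, show U' 0 = U by ext x; simp [U']] at this

theorem isShiftQuasi_sliceCount_biUnion {X α : Type*} {wt : X → ℕ} (s : Finset α) {S : α → Set X}
    (hd : ∀ i j, i ≠ j → Disjoint (S i) (S j)) (hf : FiniteSlices (⋃ i ∈ s, S i) wt)
    (hq : ∀ i ∈ s, IsShiftQuasi (sliceCount (S i) wt)) :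
    IsShiftQuasi (sliceCount (⋃ i ∈ s, S i) wt) := by
  classical
  induction s using Finset.induction_on with
  | empty => simpa [sliceCount_empty] using IsShiftQuasi.zero
  | insert a s ha ih =>
    rw [Finset.set_biUnion_insert] at hf ⊢
    have h1 := hf.mono Set.subset_union_left
    have h2 := hf.mono Set.subset_union_right
    rw [funext (sliceCount_union h1 h2 ?_)]
    · exact (hq a (by simp)).add (ih h2 fun i hi => hq i (by simp [hi]))
    · refine Set.disjoint_iUnion₂_right.2 fun j hj => hd a j ?_
      rintro rfl
      exact ha hj

/-- The solutions of a linear system over `ℕ` are counted by an eventually quasi-polynomial. -/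
theorem isShiftQuasi_sliceCount_eq {ι N : Type*} [Finite ι] [AddCommMonoid N] [IsCancelAdd N]
    (g h : (ι → ℕ) →+ N) (u v : N) (wl : (ι → ℕ) →+ ℕ)
    (hfin : FiniteSlices {x | g x + u = h x + v} wl) :
    IsShiftQuasi (sliceCount {x | g x + u = h x + v} wl) := by
  set E : Set (ι → ℕ) := {x | g x + u = h x + v} with hE
  obtain ⟨s, G, hG⟩ := AddSubmonoid.fg_iff_exists_fin_addMonoidHom.1 (AddSubmonoid.fg_eqLocusM g h)
  have hGm : ∀ μ, g (G μ) = h (G μ) := fun μ => by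
    have : G μ ∈ g.eqLocusM h := hG ▸ ⟨μ, rfl⟩
    exact this
  have hGe : ∀ x, g x = h x → ∃ μ, G μ = x := fun x hx => by
    have : x ∈ AddMonoidHom.mrange G := hG ▸ hx
    exact this
  obtain ⟨hmf, hmin⟩ := exists_finite_minimal E
  obtain ⟨q, m, hm⟩ : ∃ (q : ℕ) (m : Fin q → (ι → ℕ)), Set.range m = {x | Minimal (· ∈ E) x} := by
    have := hmf.to_subtype
    obtain ⟨q, ⟨e⟩⟩ := Finite.exists_equiv_fin {x | Minimal (· ∈ E) x}
    refine ⟨q, fun i => (e.symm i).1, ?_⟩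
    ext x
    constructor
    · rintro ⟨i, rfl⟩
      exact (e.symm i).2
    · intro hx
      exact ⟨e ⟨x, hx⟩, by simp⟩
  have hmE : ∀ i, g (m i) + u = h (m i) + v := fun i => by
    have : m i ∈ {x | Minimal (· ∈ E) x} := hm ▸ ⟨i, rfl⟩
    exact this.prop
  have hrep : ∀ x ∈ E, ∃ (i : Fin q) (μ : Fin s → ℕ), m i + G μ = x := by
    intro x hx
    obtain ⟨y, hy, hym⟩ := hmin x hx
    obtain ⟨i, rfl⟩ : y ∈ Set.range m := hm ▸ hym
    obtain ⟨z, rfl⟩ := le_iff_exists_add.1 hy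
    have hz : g z = h z := by
      change g (m i + z) + u = h (m i + z) + v at hx
      rw [map_add, map_add, add_right_comm, add_right_comm _ _ v, hmE i] at hx
      exact add_left_cancel hx
    obtain ⟨μ, rfl⟩ := hGe z hz
    exact ⟨i, μ, rfl⟩
  let key : Fin q × (Fin s → ℕ) → Fin q ×ₗ Lex (Fin s → ℕ) := fun p => toLex (p.1, toLex p.2)
  let val : Fin q × (Fin s → ℕ) → (ι → ℕ) := fun p => m p.1 + G p.2
  let U : Fin q → Set (Fin s → ℕ) := fun i => {μ | ∀ p, val p = val (i, μ) → key (i, μ) ≤ key p}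
  have hkey : ∀ p p', key p = key p' → p = p' := by
    rintro ⟨i, μ⟩ ⟨j, ν⟩ hp
    simpa [key] using hp
  have hUl : ∀ i, IsLowerSet (U i) := by
    intro i μ μ' hle hμ p hp
    obtain ⟨δ, rfl⟩ := le_iff_exists_add.1 hle
    have := hμ (p.1, p.2 + δ) (by simpa [val, ← add_assoc] using hp)
    simp only [key, Prod.Lex.toLex_le_toLex, toLex_add, add_le_add_iff_right] at this ⊢
    exact this
  have hinj : ∀ i, Set.InjOn (fun μ => val (i, μ)) (U i) := by
    intro i μ hμ ν hν hp
    have := hkey _ _ (le_antisymm (hμ _ hp.symm) (hν _ hp))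
    simpa using this
  have hUn : E = ⋃ i ∈ (Finset.univ : Finset (Fin q)), (fun μ => val (i, μ)) '' U i := by
    ext x
    simp only [Finset.mem_univ, Set.iUnion_true, Set.mem_iUnion]
    constructor
    · intro hx
      obtain ⟨i, μ, hi⟩ := hrep x hx
      obtain ⟨p, hp, hpm⟩ := (InvImage.wf key wellFounded_lt).has_min {p | val p = x} ⟨(i, μ), hi⟩
      refine ⟨p.1, p.2, fun p' hp' => ?_, hp⟩
      exact not_lt.1 (hpm p' (hp'.trans hp))
    · rintro ⟨i, μ, _, rfl⟩
      change g (m i + G μ) + u = h (m i + G μ) + v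
      rw [map_add, map_add, add_right_comm, add_right_comm _ _ v, hmE i, hGm]
  rw [hUn] at hfin ⊢
  refine isShiftQuasi_sliceCount_biUnion _ ?_ hfin fun i _ => ?_
  · intro i j hij
    rw [Set.disjoint_left]
    rintro _ ⟨μ, hμ, rfl⟩ ⟨ν, hν, hp⟩
    have := hkey _ _ (le_antisymm (hμ _ hp) (hν _ hp.symm))
    simp only [Prod.mk.injEq] at this
    exact hij this.1
  · have hf : FiniteSlices ((fun μ => val (i, μ)) '' U i) wl :=
      hfin.mono (Set.subset_biUnion_of_mem (u := fun i => (fun μ => val (i, μ)) '' U i)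
        (Finset.mem_coe.2 (Finset.mem_univ i)))
    rw [FiniteSlices.image_iff (hinj i)] at hf
    rw [sliceCount_image (hinj i)]
    have hwt : wl ∘ (fun μ => val (i, μ)) =
        fun μ => wl (m i) + ∑ j, μ j * wl (G (Pi.single j 1)) := by
      ext μ
      have hμ : μ = ∑ j, μ j • Pi.single j 1 := by
        ext l
        simp [Finset.sum_apply, Pi.single_apply]
      simp only [Function.comp_apply, val, map_add]
      conv_lhs => rw [hμ]
      simp only [map_sum, map_nsmul, smul_eq_mul]
    rw [hwt] at hf ⊢
    exact ((hUl i).isShiftQuasi_sliceCount _ hf.of_const_add).sliceCount_const_add _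

/-- Sets in affine bijection with the solutions of a linear system over `ℕ`. -/
def IsSystemSet {M : Type} [AddCommMonoid M] (S : Set M) : Prop :=
  ∃ (ι N : Type) (_ : Finite ι) (_ : AddCommMonoid N) (_ : IsCancelAdd N) (g h : (ι → ℕ) →+ N)
    (u v : N) (f : (ι → ℕ) →+ M) (a : M),
    Set.InjOn (fun x => a + f x) {x | g x + u = h x + v} ∧
      S = (fun x => a + f x) '' {x | g x + u = h x + v}

theorem IsSystemSet.inter {M : Type} [AddCommMonoid M] [IsCancelAdd M] {S T : Set M}
    (hS : IsSystemSet S) (hT : IsSystemSet T) : IsSystemSet (S ∩ T) := by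
  obtain ⟨ι, N, _, _, _, g, h, u, v, f, a, hinj, rfl⟩ := hS
  obtain ⟨ι', N', _, _, _, g', h', u', v', f', a', hinj', rfl⟩ := hT
  let l : (ι ⊕ ι' → ℕ) →+ (ι → ℕ) := (LinearMap.funLeft ℕ ℕ Sum.inl).toAddMonoidHom
  let r : (ι ⊕ ι' → ℕ) →+ (ι' → ℕ) := (LinearMap.funLeft ℕ ℕ Sum.inr).toAddMonoidHom
  have hext : ∀ x y, l x = l y → r x = r y → x = y := by
    intro x y h1 h2
    ext (i | i)
    · exact congrFun h1 i
    · exact congrFun h2 i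
  have hmem : ∀ x : ι ⊕ ι' → ℕ,
      ((g.comp l).prod ((g'.comp r).prod (f.comp l))) x + (u, u', a) =
        ((h.comp l).prod ((h'.comp r).prod (f'.comp r))) x + (v, v', a') ↔
      (g (l x) + u = h (l x) + v) ∧ (g' (r x) + u' = h' (r x) + v') ∧
        (a + f (l x) = a' + f' (r x)) := by
    intro x
    simp [Prod.ext_iff, add_comm a, add_comm a']
  refine ⟨ι ⊕ ι', N × N' × M, inferInstance, inferInstance, inferInstance,
    (g.comp l).prod ((g'.comp r).prod (f.comp l)), (h.comp l).prod ((h'.comp r).prod (f'.comp r)),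
    (u, u', a), (v, v', a'), f.comp l, a, ?_, ?_⟩
  · intro x hx y hy hxy
    rw [Set.mem_ofPred, hmem] at hx hy
    simp only [AddMonoidHom.comp_apply] at hxy
    refine hext _ _ (hinj hx.1 hy.1 hxy) (hinj' hx.2.1 hy.2.1 ?_)
    simpa only [← hx.2.2, ← hy.2.2] using hxy
  · ext z
    constructor
    · rintro ⟨⟨x, hx, hxz⟩, ⟨y, hy, hyz⟩⟩
      exact ⟨Sum.elim x y, (hmem _).2 ⟨hx, hy, hxz.trans hyz.symm⟩, hxz⟩
    · rintro ⟨x, hx, rfl⟩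
      rw [Set.mem_ofPred, hmem] at hx
      exact ⟨⟨l x, hx.1, rfl⟩, ⟨r x, hx.2.1, hx.2.2.symm⟩⟩

theorem IsSystemSet.isShiftQuasi {M : Type} [AddCommMonoid M] {S : Set M} (hS : IsSystemSet S)
    (wl : M →+ ℕ) (hfin : FiniteSlices S wl) : IsShiftQuasi (sliceCount S wl) := by
  obtain ⟨ι, N, _, _, _, g, h, u, v, f, a, hinj, rfl⟩ := hS
  rw [FiniteSlices.image_iff hinj] at hfin
  rw [sliceCount_image hinj]
  have hwt : wl ∘ (fun x => a + f x) = fun x => wl a + wl.comp f x := by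
    ext x
    simp
  rw [hwt] at hfin ⊢
  exact (isShiftQuasi_sliceCount_eq g h u v _ hfin.of_const_add).sliceCount_const_add _

theorem IsProperLinearSet.isSystemSet {M : Type} [AddCommMonoid M] [IsCancelAdd M] {S : Set M}
    (hS : IsProperLinearSet S) : IsSystemSet S := by
  obtain ⟨a, t, ht, hli, rfl⟩ := hS
  have := ht.to_subtype
  have := Fintype.ofFinite t
  let f : (t → ℕ) →ₗ[ℕ] M := Fintype.linearCombination ℕ (fun i : t => (i : M))
  have hf : Function.Injective f := linearIndependent_iff_injective_fintypeLinearCombination.1 hli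
  refine ⟨t, ℕ, inferInstance, inferInstance, inferInstance, 0, 0, 0, 0, f.toAddMonoidHom, a,
    ?_, ?_⟩
  · intro x _ y _ hxy
    exact hf (add_left_cancel hxy)
  · ext z
    have hr : ∀ y, y ∈ AddSubmonoid.closure t ↔ ∃ x, f x = y := by
      intro y
      have h1 : LinearMap.range f = Submodule.span ℕ t := by
        simp [f, Fintype.range_linearCombination]
      rw [← Submodule.span_nat_eq_addSubmonoidClosure]
      change y ∈ Submodule.span ℕ t ↔ _
      rw [← h1, LinearMap.mem_range]
    simp [Set.mem_vadd_set, hr]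

/-- Inclusion-exclusion for finite unions of solution sets. -/
theorem isShiftQuasi_sliceCount_list {M : Type} [AddCommMonoid M] [IsCancelAdd M] (wl : M →+ ℕ)
    (q : ℕ) : ∀ S : Fin q → Set M, (∀ i, IsSystemSet (S i)) → FiniteSlices (⋃ i, S i) wl →
      IsShiftQuasi (sliceCount (⋃ i, S i) wl) := by
  induction q with
  | zero =>
    intro S _ _
    rw [Set.iUnion_of_empty, sliceCount_empty]
    exact .zero
  | succ q ih =>
    intro S hS hfin
    have hU : ⋃ i, S i = S 0 ∪ ⋃ i : Fin q, S i.succ := by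
      ext x
      simp [Fin.exists_fin_succ]
    rw [hU] at hfin ⊢
    have h1 := hfin.mono Set.subset_union_left
    have h2 := hfin.mono Set.subset_union_right
    have hI : S 0 ∩ ⋃ i : Fin q, S i.succ = ⋃ i : Fin q, S 0 ∩ S i.succ := Set.inter_iUnion _ _
    have h3 := ih (fun i => S i.succ) (fun i => hS _) h2
    have h4 := ih (fun i => S 0 ∩ S i.succ) (fun i => (hS 0).inter (hS _))
      (h1.mono (hI ▸ Set.inter_subset_left))
    rw [← hI] at h4
    refine ((((hS 0).isShiftQuasi wl h1).add h3).sub h4).congr 0 fun n _ => ?_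
    rw [eq_sub_iff_add_eq, sliceCount_union_add_inter h1 h2]

/-- The slices of a semilinear set are counted by an eventually quasi-polynomial. -/
theorem IsSemilinearSet.isShiftQuasi_sliceCount {M : Type} [AddCommMonoid M] [IsCancelAdd M]
    {S : Set M} (hS : IsSemilinearSet S) (wl : M →+ ℕ) (hfin : FiniteSlices S wl) :
    IsShiftQuasi (sliceCount S wl) := by
  obtain ⟨𝒯, h𝒯, hp, rfl⟩ := hS.isProperSemilinearSet
  have := h𝒯.to_subtype
  obtain ⟨q, ⟨e⟩⟩ := Finite.exists_equiv_fin 𝒯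
  have hU : ⋃₀ 𝒯 = ⋃ i, ((e.symm i : 𝒯) : Set M) := by
    rw [Set.sUnion_eq_iUnion]
    exact (e.symm.surjective.iUnion_comp (fun T : 𝒯 => (T : Set M))).symm
  rw [hU] at hfin ⊢
  exact isShiftQuasi_sliceCount_list wl q _ (fun i => (hp _ (e.symm i).2).isSystemSet) hfin

/-! ### Integer-valued affine functions and polynomial combinations of digits -/

/-- An affine function with integer coefficients. -/
def IsAffine {α : Type} [Fintype α] (A : (α → ℕ) → ℤ) : Prop :=
  ∃ (c : ℤ) (a : α → ℤ), ∀ x, A x = c + ∑ p, a p * x p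

namespace IsAffine

variable {α : Type} [Fintype α] {A B : (α → ℕ) → ℤ}

theorem const (c : ℤ) : IsAffine (fun _ : α → ℕ => c) := ⟨c, 0, fun x => by simp⟩

theorem apply (p : α) : IsAffine (fun x : α → ℕ => (x p : ℤ)) := by
  classical
  exact ⟨0, Pi.single p 1, fun x => by simp [Pi.single_apply]⟩

theorem add (hA : IsAffine A) (hB : IsAffine B) : IsAffine (fun x => A x + B x) := by
  obtain ⟨c, a, h⟩ := hA
  obtain ⟨c', a', h'⟩ := hB
  refine ⟨c + c', a + a', fun x => ?_⟩
  simp only [h, h', Pi.add_apply, add_mul, Finset.sum_add_distrib]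
  ring

theorem smul (t : ℤ) (hA : IsAffine A) : IsAffine (fun x => t * A x) := by
  obtain ⟨c, a, h⟩ := hA
  refine ⟨t * c, fun p => t * a p, fun x => ?_⟩
  simp only [h, mul_add, Finset.mul_sum, mul_assoc]

theorem isSemilinearSet_nonneg (hA : IsAffine A) : IsSemilinearSet {x | 0 ≤ A x} := by
  obtain ⟨c, a, h⟩ := hA
  have hS : {x | 0 ≤ A x} = {x | ∃ y : Unit → ℕ, c + ∑ p, a p * x p = y ()} := by
    ext x
    simp only [Set.mem_ofPred, h]
    constructor
    · intro hx
      exact ⟨fun _ => (c + ∑ p, a p * (x p : ℤ)).toNat, by simp [hx]⟩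
    · rintro ⟨y, hy⟩
      rw [hy]
      positivity
  rw [hS]
  apply IsSemilinearSet.proj'
  let f : (α ⊕ Unit → ℕ) →+ ℤ :=
    { toFun := fun z => ∑ p, a p * z (Sum.inl p)
      map_zero' := by simp
      map_add' := fun y z => by simp [mul_add, Finset.sum_add_distrib] }
  let g : (α ⊕ Unit → ℕ) →+ ℤ :=
    { toFun := fun z => z (Sum.inr ())
      map_zero' := by simp
      map_add' := fun y z => by simp }
  have := isSemilinearSet_setOfPred_eq c 0 f g
  simpa [f, g] using this

end IsAffine

/-- The points all of whose coordinates are less than the distinguished one. -/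
def digitDomain (β : Type) : Set (Option β → ℕ) := {x | 0 < x none ∧ ∀ p, x (some p) < x none}

theorem isSemilinearSet_digitDomain (β : Type) [Fintype β] : IsSemilinearSet (digitDomain β) := by
  have hS : digitDomain β = {x | 0 ≤ (x none : ℤ) + -1} ∩
      ⋂ p : β, {x | 0 ≤ ((x none : ℤ) + (-1) * x (some p)) + -1} := by
    ext x
    simp only [digitDomain, Set.mem_ofPred, Set.mem_inter_iff, Set.mem_iInter]
    refine and_congr (by omega) (forall_congr' fun p => by omega)
  rw [hS]
  exact ((IsAffine.apply none).add (.const _)).isSemilinearSet_nonneg.inter <|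
    .iInter fun p => (((IsAffine.apply none).add ((IsAffine.apply _).smul _)).add
      (.const _)).isSemilinearSet_nonneg

theorem IsAffine.exists_bound {β : Type} [Fintype β] {A : (Option β → ℕ) → ℤ} (hA : IsAffine A) :
    ∃ C : ℤ, ∀ x ∈ digitDomain β, -(x none * C) ≤ A x ∧ A x < x none * C := by
  obtain ⟨c, a, h⟩ := hA
  refine ⟨|c| + ∑ p, |a p| + 1, fun x ⟨h0, hx⟩ => ?_⟩
  have h1 : |A x| ≤ x none * (|c| + ∑ p, |a p|) := by
    rw [h, mul_add, Finset.mul_sum]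
    refine (abs_add_le _ _).trans (add_le_add ?_ ((Finset.abs_sum_le_sum_abs _ _).trans
      (Finset.sum_le_sum fun p _ => ?_)))
    · have : (1 : ℤ) ≤ x none := by omega
      nlinarith [abs_nonneg c]
    · rw [abs_mul, mul_comm, Nat.abs_cast]
      have : (x p : ℤ) ≤ x none := by
        cases p with
        | none => rfl
        | some p => exact_mod_cast (hx p).le
      exact mul_le_mul_of_nonneg_right this (abs_nonneg _)
  rw [mul_add, mul_one]
  have := abs_le.1 h1
  omega

/-- Polynomials in the distinguished coordinate whose coefficients are affine functions. -/
inductive IsDigitPoly {β : Type} [Fintype β] : ((Option β → ℕ) → ℤ) → Prop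
  | affine {A : (Option β → ℕ) → ℤ} (hA : IsAffine A) : IsDigitPoly A
  | cons {A B : (Option β → ℕ) → ℤ} (hA : IsAffine A) (hB : IsDigitPoly B) :
      IsDigitPoly (fun x => A x + x none * B x)

namespace IsDigitPoly

variable {β : Type} [Fintype β] {A B : (Option β → ℕ) → ℤ}

theorem congr (hA : IsDigitPoly A) (h : ∀ x, B x = A x) : IsDigitPoly B := funext h ▸ hA

theorem affine_add (hA : IsAffine A) (hB : IsDigitPoly B) : IsDigitPoly (fun x => A x + B x) := by
  cases hB with
  | affine hB => exact .affine (hA.add hB)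
  | cons hC hD => exact (IsDigitPoly.cons (hA.add hC) hD).congr fun x => by ring

theorem add (hA : IsDigitPoly A) (hB : IsDigitPoly B) : IsDigitPoly (fun x => A x + B x) := by
  induction hA generalizing B with
  | affine hA => exact affine_add hA hB
  | cons hA' hA ih =>
    cases hB with
    | affine hB => exact (affine_add hB (.cons hA' hA)).congr fun x => by ring
    | cons hC hD => exact (IsDigitPoly.cons (hA'.add hC) (ih hD)).congr fun x => by ring

theorem smul (t : ℤ) (hA : IsDigitPoly A) : IsDigitPoly (fun x => t * A x) := by
  induction hA with
  | affine hA => exact .affine (hA.smul t)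
  | cons hA' hA ih => exact (IsDigitPoly.cons (hA'.smul t) ih).congr fun x => by ring

theorem pow_mul (e : ℕ) (hA : IsDigitPoly A) : IsDigitPoly (fun x => (x none : ℤ) ^ e * A x) := by
  induction e with
  | zero => exact hA.congr fun x => by ring
  | succ e ih => exact (IsDigitPoly.cons (.const 0) ih).congr fun x => by ring

theorem sum {γ : Type*} (s : Finset γ) {f : γ → (Option β → ℕ) → ℤ}
    (hf : ∀ i ∈ s, IsDigitPoly (f i)) : IsDigitPoly (fun x => ∑ i ∈ s, f i x) := by
  classical
  induction s using Finset.induction_on with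
  | empty => simpa using IsDigitPoly.affine (.const 0)
  | insert a s ha ih =>
    simp only [Finset.sum_insert ha]
    exact (hf a (by simp)).add (ih fun i hi => hf i (by simp [hi]))

theorem eval_mul (p : Polynomial ℤ) (hA : IsDigitPoly A) :
    IsDigitPoly (fun x => p.eval (x none : ℤ) * A x) := by
  simp only [Polynomial.eval_eq_sum_range, Finset.sum_mul]
  exact sum _ fun e _ => ((hA.pow_mul e).smul (p.coeff e)).congr fun x => by ring

theorem isSemilinearSet_affine_add_nonneg (hB : IsDigitPoly B) (hA : IsAffine A) :
    IsSemilinearSet (digitDomain β ∩ {x | 0 ≤ A x + B x}) := by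
  induction hB generalizing A with
  | affine hB => exact (isSemilinearSet_digitDomain β).inter (hA.add hB).isSemilinearSet_nonneg
  | @cons A' B hA' hB ih =>
    have hA := hA.add hA'
    obtain ⟨C, hC⟩ := hA.exists_bound
    have hS : digitDomain β ∩ {x | 0 ≤ A x + (A' x + x none * B x)} =
        ⋃ q ∈ Finset.Icc (-C) C, ({x | 0 ≤ (A x + A' x) + (-q) * x none} ∩
          {x | 0 ≤ ((q + 1) * x none + (-1) * (A x + A' x)) + -1}) ∩
          (digitDomain β ∩ {x | 0 ≤ q + B x}) := by
      ext x
      simp only [Set.mem_inter_iff, Set.mem_iUnion, Set.mem_ofPred, Finset.mem_Icc]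
      constructor
      · rintro ⟨hx, h⟩
        have hn : (0 : ℤ) < x none := by exact_mod_cast hx.1
        obtain ⟨hl, hu⟩ := hC x hx
        have e1 := Int.mul_ediv_add_emod (A x + A' x) (x none)
        have e2 := Int.emod_nonneg (A x + A' x) hn.ne'
        have e3 := Int.emod_lt_of_pos (A x + A' x) hn
        set q := (A x + A' x) / (x none : ℤ)
        refine ⟨q, ⟨?_, ?_⟩, ⟨by nlinarith, by nlinarith⟩, hx, ?_⟩
        · by_contra! hlt
          nlinarith
        · by_contra! hlt
          nlinarith
        · by_contra! hlt
          nlinarith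
      · rintro ⟨q, -, ⟨h1, h2⟩, hx, h3⟩
        refine ⟨hx, ?_⟩
        have hn : (0 : ℤ) < x none := by exact_mod_cast hx.1
        nlinarith
    rw [hS]
    refine .biUnion_finset fun q _ => (IsSemilinearSet.inter ?_ ?_).inter (ih (.const q))
    · exact (hA.add ((IsAffine.apply _).smul _)).isSemilinearSet_nonneg
    · exact ((((IsAffine.apply _).smul _).add (hA.smul _)).add (.const _)).isSemilinearSet_nonneg

theorem isSemilinearSet_nonneg (hB : IsDigitPoly B) :
    IsSemilinearSet {x | x ∈ digitDomain β ∧ 0 ≤ B x} := by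
  have := hB.isSemilinearSet_affine_add_nonneg (.const 0)
  simp only [zero_add] at this
  exact this

end IsDigitPoly

/-! ### Sets definable through digit expansions -/

theorem digits_sum_lt {n D : ℕ} {d : Fin D → ℕ} (hd : ∀ e, d e < n) :
    ∑ e, d e * n ^ (e : ℕ) < n ^ D := by
  simpa using (finFunctionFinEquiv fun e => (⟨d e, hd e⟩ : Fin n)).2

theorem exists_digits {n D v : ℕ} (hv : v < n ^ D) :
    ∃ d : Fin D → ℕ, (∀ e, d e < n) ∧ ∑ e, d e * n ^ (e : ℕ) = v := by
  refine ⟨fun e => finFunctionFinEquiv.symm ⟨v, hv⟩ e, fun e => (finFunctionFinEquiv.symm _ e).2, ?_⟩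
  rw [← finFunctionFinEquiv_apply, Equiv.apply_symm_apply]

theorem digits_injective {n D : ℕ} {d d' : Fin D → ℕ} (hd : ∀ e, d e < n) (hd' : ∀ e, d' e < n)
    (h : ∑ e, d e * n ^ (e : ℕ) = ∑ e, d' e * n ^ (e : ℕ)) : d = d' := by
  have : (fun e => (⟨d e, hd e⟩ : Fin n)) = fun e => ⟨d' e, hd' e⟩ :=
    finFunctionFinEquiv.injective (Fin.ext (by simpa using h))
  ext e
  simpa using congrFun this e

/-- The numbers whose base `x none` expansions are the remaining coordinates of `x`. -/
def digitValue {ι : Type} {D : ℕ} (x : Option (ι × Fin D) → ℕ) (i : ι) : ℕ :=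
  ∑ e, x (some (i, e)) * x none ^ (e : ℕ)

theorem digitValue_lt {ι : Type} {D : ℕ} {x : Option (ι × Fin D) → ℕ}
    (hx : x ∈ digitDomain (ι × Fin D)) (i : ι) : digitValue x i < x none ^ D :=
  digits_sum_lt fun e => hx.2 (i, e)

theorem isDigitPoly_digitValue {ι : Type} [Fintype ι] {D : ℕ} (i : ι) :
    IsDigitPoly (fun x : Option (ι × Fin D) → ℕ => (digitValue x i : ℤ)) := by
  simp only [digitValue, Nat.cast_sum, Nat.cast_mul, Nat.cast_pow]
  exact .sum _ fun e _ => ((IsDigitPoly.affine (.apply _)).pow_mul e).congr fun x => mul_comm _ _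

/-- `P n u` is definable for tuples `u` of numbers with at most `D` digits in base `n` when it
is a semilinear condition on the digits. -/
def DigitDefinable {ι : Type} (D : ℕ) (P : ℕ → (ι → ℕ) → Prop) : Prop :=
  IsSemilinearSet {x | x ∈ digitDomain (ι × Fin D) ∧ P (x none) (digitValue x)}

namespace DigitDefinable

variable {ι κ : Type} {D : ℕ} {P Q : ℕ → (ι → ℕ) → Prop}

theorem congr (hP : DigitDefinable D P) (h : ∀ n u, (∀ i, u i < n ^ D) → (Q n u ↔ P n u)) :
    DigitDefinable D Q := by
  unfold DigitDefinable at hP ⊢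
  convert hP using 2
  ext x
  exact and_congr_right fun hx => h _ _ (digitValue_lt hx)

theorem and (hP : DigitDefinable D P) (hQ : DigitDefinable D Q) :
    DigitDefinable D (fun n u => P n u ∧ Q n u) := by
  unfold DigitDefinable
  convert IsSemilinearSet.inter hP hQ using 1
  ext x
  simp only [Set.mem_ofPred, Set.mem_inter_iff]
  tauto

theorem not [Fintype ι] (hP : DigitDefinable D P) : DigitDefinable D (fun n u => ¬ P n u) := by
  unfold DigitDefinable
  convert (isSemilinearSet_digitDomain (ι × Fin D)).inter (IsSemilinearSet.compl hP) using 1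
  ext x
  simp only [Set.mem_ofPred, Set.mem_inter_iff, Set.mem_compl_iff]
  tauto

theorem or [Fintype ι] (hP : DigitDefinable D P) (hQ : DigitDefinable D Q) :
    DigitDefinable D (fun n u => P n u ∨ Q n u) :=
  (hP.not.and hQ.not).not.congr fun n u _ => by tauto

theorem imp [Fintype ι] (hP : DigitDefinable D P) (hQ : DigitDefinable D Q) :
    DigitDefinable D (fun n u => P n u → Q n u) :=
  (hP.not.or hQ).congr fun n u _ => by tauto

theorem iff [Fintype ι] (hP : DigitDefinable D P) (hQ : DigitDefinable D Q) :
    DigitDefinable D (fun n u => P n u ↔ Q n u) :=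
  ((hP.imp hQ).and (hQ.imp hP)).congr fun n u _ => by tauto

theorem const [Fintype ι] (p : Prop) : DigitDefinable D (fun _ (_ : ι → ℕ) => p) := by
  unfold DigitDefinable
  by_cases hp : p
  · simpa [hp] using isSemilinearSet_digitDomain (ι × Fin D)
  · simp [hp]

theorem all [Fintype ι] {γ : Type*} [Finite γ] {P : γ → ℕ → (ι → ℕ) → Prop}
    (hP : ∀ i, DigitDefinable D (P i)) : DigitDefinable D (fun n u => ∀ i, P i n u) := by
  unfold DigitDefinable
  convert (isSemilinearSet_digitDomain (ι × Fin D)).inter (IsSemilinearSet.iInter hP) using 1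
  ext x
  simp only [Set.mem_ofPred, Set.mem_inter_iff, Set.mem_iInter]
  exact ⟨fun h => ⟨h.1, fun i => ⟨h.1, h.2 i⟩⟩, fun h => ⟨h.1, fun i => (h.2 i).2⟩⟩

theorem ex [Fintype ι] {γ : Type*} [Finite γ] {P : γ → ℕ → (ι → ℕ) → Prop}
    (hP : ∀ i, DigitDefinable D (P i)) : DigitDefinable D (fun n u => ∃ i, P i n u) :=
  (all fun i => (hP i).not).not.congr fun n u _ => by push Not; rfl

theorem nonneg [Fintype ι] (p₀ : Polynomial ℤ) (p : ι → Polynomial ℤ) :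
    DigitDefinable D (fun n (u : ι → ℕ) => 0 ≤ p₀.eval (n : ℤ) + ∑ i, (p i).eval (n : ℤ) * u i) := by
  refine IsDigitPoly.isSemilinearSet_nonneg (B := fun x => p₀.eval (x none : ℤ) +
    ∑ i, (p i).eval (x none : ℤ) * digitValue x i) (.add ?_ (.sum _ fun i _ => ?_))
  · exact ((IsDigitPoly.affine (.const 1)).eval_mul p₀).congr fun x => by ring
  · exact (isDigitPoly_digitValue i).eval_mul (p i)

theorem reindex [Fintype κ] (f : ι → κ) (hP : DigitDefinable D P) :
    DigitDefinable D (fun n (u : κ → ℕ) => P n (u ∘ f)) := by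
  unfold DigitDefinable at hP ⊢
  convert (isSemilinearSet_digitDomain (κ × Fin D)).inter
    (hP.preimage (LinearMap.funLeft ℕ ℕ (Option.map (Prod.map f id)))) using 1
  ext x
  simp only [Set.mem_ofPred, Set.mem_inter_iff, Set.mem_preimage]
  exact ⟨fun h => ⟨h.1, ⟨h.1.1, fun p => h.1.2 _⟩, h.2⟩, fun h => ⟨h.1, h.2.2⟩⟩

theorem exists_lt {P : ℕ → (ι ⊕ κ → ℕ) → Prop} (hP : DigitDefinable D P) :
    DigitDefinable D (fun n u => ∃ v : κ → ℕ, (∀ j, v j < n ^ D) ∧ P n (Sum.elim u v)) := by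
  unfold DigitDefinable at hP ⊢
  convert hP.image (LinearMap.funLeft ℕ ℕ (Option.map (Prod.map Sum.inl id))) using 1
  ext x
  simp only [Set.mem_ofPred, Set.mem_image]
  constructor
  · rintro ⟨hx, v, hv, h⟩
    choose d hd hdv using fun j => exists_digits (hv j)
    let y : Option ((ι ⊕ κ) × Fin D) → ℕ := fun p => p.elim (x none) fun q =>
      Sum.elim (fun i => x (some (i, q.2))) (fun j => d j q.2) q.1
    have hy : digitValue y = Sum.elim (digitValue x) v := by
      ext (i | j)
      · rfl
      · exact hdv j
    refine ⟨y, ⟨⟨hx.1, ?_⟩, ?_⟩, ?_⟩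
    · rintro ⟨i | j, e⟩
      · exact hx.2 (i, e)
      · exact hd j e
    · rwa [hy]
    · ext (_ | ⟨i, e⟩) <;> rfl
  · rintro ⟨y, ⟨hy, h⟩, rfl⟩
    refine ⟨⟨hy.1, fun p => hy.2 _⟩, fun j => digitValue y (Sum.inr j),
      fun j => digitValue_lt hy _, ?_⟩
    have he : Sum.elim (digitValue (LinearMap.funLeft ℕ ℕ (Option.map (Prod.map Sum.inl id)) y))
        (fun j => digitValue y (Sum.inr j)) = digitValue y := by
      ext (i | j) <;> rfl
    rw [he]
    exact h

theorem isShiftQuasi_ncard [Fintype ι] (hP : DigitDefinable D P) :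
    IsShiftQuasi (fun n => ({u : ι → ℕ | (∀ i, u i < n ^ D) ∧ P n u}.ncard : ℤ)) := by
  let wl : (Option (ι × Fin D) → ℕ) →+ ℕ := Pi.evalAddMonoidHom _ none
  have hfin : FiniteSlices {x | x ∈ digitDomain (ι × Fin D) ∧ P (x none) (digitValue x)} wl := by
    intro n
    refine (Set.Finite.pi' fun _ : Option (ι × Fin D) => Set.finite_Iic n).subset ?_
    rintro x ⟨⟨hx, -⟩, rfl⟩ (_ | p)
    · exact le_refl (x none)
    · exact (hx.2 p).le
  refine (IsSemilinearSet.isShiftQuasi_sliceCount hP wl hfin).congr 1 fun n hn => ?_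
  rw [sliceCount]
  congr 1
  symm
  refine Set.ncard_congr (fun x _ => digitValue x) ?_ ?_ ?_
  · rintro x ⟨⟨hx, h⟩, rfl⟩
    exact ⟨digitValue_lt hx, h⟩
  · rintro x y ⟨⟨hx, -⟩, rfl⟩ ⟨⟨hy, -⟩, hxy⟩ h
    change y none = x none at hxy
    ext (_ | ⟨i, e⟩)
    · exact hxy.symm
    · refine congrFun (digits_injective (n := x none) (fun e => hx.2 (i, e))
        (fun e => hxy ▸ hy.2 (i, e)) ?_) e
      have := congrFun h i
      simpa only [digitValue, hxy] using this
  · rintro u ⟨hu, h⟩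
    choose d hd hdu using fun i => exists_digits (hu i)
    let x : Option (ι × Fin D) → ℕ := fun p => p.elim n fun q => d q.1 q.2
    have hx : digitValue x = u := funext hdu
    refine ⟨x, ⟨⟨⟨hn, fun p => hd _ _⟩, ?_⟩, rfl⟩, hx⟩
    rw [hx]
    exact h

end DigitDefinable

/-! ### Small zero-sum submultisets -/

theorem Multiset.exists_list_abs_sum_le {Λ : Type*} (s : Λ → ℤ) {S : ℕ} {z : Multiset Λ}
    (hS : ∀ a ∈ z, |s a| ≤ S) (h0 : (z.map s).sum = 0) (t : ℕ) (ht : t ≤ z.card) :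
    ∃ l : List Λ, l.length = t ∧ (l : Multiset Λ) ≤ z ∧
      ∀ i, |((l.drop i).map s).sum| ≤ S := by
  classical
  induction t with
  | zero => exact ⟨[], rfl, by simp, by simp⟩
  | succ t ih =>
    obtain ⟨l, hl, hlz, hsum⟩ := ih (by omega)
    obtain ⟨r, rfl⟩ := Multiset.le_iff_exists_add.1 hlz
    have hr : r ≠ 0 := by
      rintro rfl
      simp [hl] at ht
    have hr0 : (l.map s).sum + (r.map s).sum = 0 := by simpa using h0
    have hb := abs_le.1 (by simpa using hsum 0 : |(l.map s).sum| ≤ S)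
    obtain ⟨a, har, ha⟩ : ∃ a ∈ r, |s a + (l.map s).sum| ≤ S := by
      by_contra! hcon
      rcases le_total (l.map s).sum 0 with hneg | hpos
      · have : (r.map s).sum < (r.map fun _ => (0 : ℤ)).sum := by
          refine Multiset.sum_lt_sum_of_nonempty hr fun a ha => ?_
          by_contra! h
          refine (hcon a ha).not_ge (abs_le.2 ?_)
          have := abs_le.1 (hS a (by simp [ha]))
          omega
        simp at this
        omega
      · have : (r.map fun _ => (0 : ℤ)).sum < (r.map s).sum := by
          refine Multiset.sum_lt_sum_of_nonempty hr fun a ha => ?_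
          by_contra! h
          refine (hcon a ha).not_ge (abs_le.2 ?_)
          have := abs_le.1 (hS a (by simp [ha]))
          omega
        simp at this
        omega
    refine ⟨a :: l, by simp [hl], ?_, ?_⟩
    · rw [← Multiset.cons_coe, ← Multiset.singleton_add, add_comm]
      gcongr
      simpa using har
    · rintro (_ | i)
      · simpa using ha
      · simpa using hsum i

theorem Multiset.exists_zeroSum_card_le_int {Λ : Type*} (s : Λ → ℤ) {S : ℕ} {z : Multiset Λ}
    (hS : ∀ a ∈ z, |s a| ≤ S) (hz : z ≠ 0) (h0 : (z.map s).sum = 0) :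
    ∃ y ≤ z, y ≠ 0 ∧ (y.map s).sum = 0 ∧ y.card ≤ 2 * S + 1 := by
  by_cases hc : z.card ≤ 2 * S + 1
  · exact ⟨z, le_rfl, hz, h0, hc⟩
  obtain ⟨l, hl, hlz, hsum⟩ := exists_list_abs_sum_le s hS h0 (2 * S + 1) (by omega)
  obtain ⟨i, hi, j, hj, hne, hij⟩ := Finset.exists_ne_map_eq_of_card_lt_of_maps_to
    (s := Finset.range (2 * S + 2)) (t := Finset.Icc (-(S : ℤ)) S)
    (f := fun i => ((l.drop i).map s).sum) (by simp; omega)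
    (fun i _ => by simpa [abs_le] using hsum i)
  wlog hlt : i < j generalizing i j
  · exact this j hj i hi hne.symm hij.symm (by omega)
  simp only [Finset.mem_range] at hj
  have hsplit : l.drop i = (l.drop i).take (j - i) ++ l.drop j := by
    conv_lhs => rw [← List.take_append_drop (j - i) (l.drop i), List.drop_drop]
    rw [Nat.add_sub_cancel' hlt.le]
  have hlen : ((l.drop i).take (j - i)).length = j - i := by
    simp [hl]
    omega
  refine ⟨((l.drop i).take (j - i) : List Λ), le_trans ?_ hlz, ?_, ?_, ?_⟩
  · exact ((List.take_sublist _ _).trans (List.drop_sublist _ _)).subperm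
  · intro h
    have := congrArg Multiset.card h
    simp only [Multiset.coe_card, hlen, Multiset.card_zero] at this
    omega
  · rw [hsplit, List.map_append, List.sum_append] at hij
    simpa using hij
  · rw [Multiset.coe_card, hlen]
    omega

theorem Multiset.exists_join_of_exists_le {Λ A : Type*} [AddCommGroup A] (f : Λ → A) {b : ℕ}
    (z : Multiset Λ) (H : ∀ y ≤ z, y ≠ 0 → (y.map f).sum = 0 →
      ∃ y' ≤ y, y' ≠ 0 ∧ (y'.map f).sum = 0 ∧ y'.card ≤ b) (h0 : (z.map f).sum = 0) :
    ∃ w : Multiset (Multiset Λ), w.join = z ∧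
      ∀ p ∈ w, p ≠ 0 ∧ (p.map f).sum = 0 ∧ p.card ≤ b := by
  induction hc : z.card using Nat.strong_induction_on generalizing z with
  | _ c ih =>
    by_cases hz : z = 0
    · exact ⟨0, by simp [hz], by simp⟩
    obtain ⟨y, hyz, hy0, hys, hyb⟩ := H z le_rfl hz h0
    obtain ⟨r, rfl⟩ := Multiset.le_iff_exists_add.1 hyz
    have hlt : r.card < c := by
      have := Multiset.card_pos.2 hy0
      rw [card_add] at hc
      omega
    obtain ⟨w, rfl, hw⟩ := ih _ hlt r (fun y' hy' => H y' (hy'.trans (le_add_left r y)))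
      (by simpa [hys] using h0) rfl
    refine ⟨y ::ₘ w, by simp, fun p hp => ?_⟩
    rcases Multiset.mem_cons.1 hp with rfl | hp
    · exact ⟨hy0, hys, hyb⟩
    · exact hw p hp

/-- A bound for the size of minimal zero-sum multisets of integer vectors. -/
def zeroSumBound : ℕ → ℕ → ℕ
  | 0, _ => 1
  | m + 1, S => (2 * (zeroSumBound m S * S) + 1) * zeroSumBound m S

theorem Multiset.exists_zeroSum_card_le {Λ : Type*} {m S : ℕ} (f : Λ → Fin m → ℤ) (z : Multiset Λ)
    (hS : ∀ a ∈ z, ∀ j, |f a j| ≤ S) (hz : z ≠ 0) (h0 : (z.map f).sum = 0) :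
    ∃ y ≤ z, y ≠ 0 ∧ (y.map f).sum = 0 ∧ y.card ≤ zeroSumBound m S := by
  induction m generalizing z with
  | zero =>
    obtain ⟨a, ha⟩ := Multiset.exists_mem_of_ne_zero hz
    exact ⟨{a}, by simpa using ha, by simp, Subsingleton.elim _ _, by simp [zeroSumBound]⟩
  | succ m ih =>
    have happ : ∀ (y : Multiset Λ) j, (y.map f).sum j = (y.map fun a => f a j).sum := by
      intro y j
      simpa [Multiset.map_map] using map_multiset_sum (Pi.evalAddMonoidHom (fun _ => ℤ) j) (y.map f)
    have happ' : ∀ (y : Multiset Λ) j,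
        (y.map fun a => Fin.tail (f a)).sum j = (y.map fun a => f a j.succ).sum := by
      intro y j
      refine (map_multiset_sum (Pi.evalAddMonoidHom (fun _ => ℤ) j) _).trans ?_
      rw [Multiset.map_map]
      rfl
    obtain ⟨w, rfl, hw⟩ := exists_join_of_exists_le (fun a => Fin.tail (f a))
      (b := zeroSumBound m S) z
      (fun y hy hy0 hys => ih _ y (fun a ha j => hS a (Multiset.mem_of_le hy ha) _) hy0 hys)
      (by ext j; rw [happ', ← happ, h0]; rfl)
    obtain ⟨w', hw', hw0, hws, hwc⟩ := exists_zeroSum_card_le_int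
      (fun p : Multiset Λ => (p.map fun a => f a 0).sum) (S := zeroSumBound m S * S) (z := w)
      (fun p hp => by
        refine (Multiset.abs_sum_le_sum_abs).trans ?_
        rw [Multiset.map_map]
        refine (Multiset.sum_le_card_nsmul _ (S : ℤ) ?_).trans ?_
        · intro x hx
          obtain ⟨a, ha, rfl⟩ := Multiset.mem_map.1 hx
          exact hS a (Multiset.mem_join.2 ⟨p, hp, ha⟩) 0
        · rw [Multiset.card_map, nsmul_eq_mul]
          exact_mod_cast Nat.mul_le_mul_right S (hw p hp).2.2)
      (by rintro rfl; simp at hz)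
      (by
        have := congrFun h0 0
        rw [happ] at this
        simpa [Multiset.map_join, Multiset.sum_join, Multiset.map_map] using this)
    obtain ⟨r, rfl⟩ := Multiset.le_iff_exists_add.1 hw'
    refine ⟨w'.join, by simp [Multiset.join_add], ?_, ?_, ?_⟩
    · obtain ⟨p, hp⟩ := Multiset.exists_mem_of_ne_zero hw0
      obtain ⟨a, ha⟩ := Multiset.exists_mem_of_ne_zero (hw p (by simp [hp])).1
      intro h
      have : a ∈ w'.join := Multiset.mem_join.2 ⟨p, hp, ha⟩
      simp [h] at this
    · ext j
      refine Fin.cases ?_ (fun j => ?_) j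
      · rw [happ]
        simpa [Multiset.map_join, Multiset.sum_join, Multiset.map_map] using hws
      · rw [happ, Multiset.map_join, Multiset.sum_join, Multiset.map_map]
        refine Multiset.sum_eq_zero fun x hx => ?_
        obtain ⟨p, hp, rfl⟩ := Multiset.mem_map.1 hx
        have := congrFun (hw p (by simp [hp])).2.1 j
        rw [happ'] at this
        simpa using this
    · rw [Multiset.card_join, zeroSumBound]
      refine (Multiset.sum_le_card_nsmul _ (zeroSumBound m S) ?_).trans ?_
      · intro x hx
        obtain ⟨p, hp, rfl⟩ := Multiset.mem_map.1 hx
        exact (hw p (by simp [hp])).2.2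
      · rw [Multiset.card_map, smul_eq_mul]
        gcongr

theorem zeroSumBound_pow_le (m d : ℕ) : ∃ D, ∀ n, 3 ≤ n → zeroSumBound m (n ^ d) ≤ n ^ D := by
  induction m with
  | zero => exact ⟨0, fun n _ => by simp [zeroSumBound]⟩
  | succ m ih =>
    obtain ⟨D, hD⟩ := ih
    refine ⟨1 + (D + d) + D, fun n hn => ?_⟩
    have h1 := hD n hn
    have h2 : 0 < n ^ (D + d) := by positivity
    calc zeroSumBound (m + 1) (n ^ d)
        = (2 * (zeroSumBound m (n ^ d) * n ^ d) + 1) * zeroSumBound m (n ^ d) := rfl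
      _ ≤ (2 * (n ^ D * n ^ d) + 1) * n ^ D := by gcongr
      _ ≤ (n * n ^ (D + d)) * n ^ D := by
        gcongr
        rw [← pow_add]
        nlinarith
      _ = n ^ (1 + (D + d) + D) := by ring

/-- The exponent of the image of the monomial with exponent `u` under `x i ↦ y ^ a i`. -/
def toricDegree {ι : Type} [Fintype ι] {m : ℕ} (a : ι → Fin m → ℕ) (u : ι → ℕ) (j : Fin m) : ℕ :=
  ∑ i, u i * a i j

/-- A nontrivial relation between monomials dominates a small one. -/
theorem exists_small_relation {ι : Type} [Fintype ι] {m S : ℕ} (a : ι → Fin m → ℕ)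
    (ha : ∀ i j, a i j ≤ S) {u v : ι → ℕ} (huv : toricDegree a u = toricDegree a v) (hu : u ≠ 0) :
    ∃ u' ≤ u, ∃ v' ≤ v, (u' ≠ 0 ∨ v' ≠ 0) ∧ toricDegree a u' = toricDegree a v' ∧
      ∀ i, u' i ≤ zeroSumBound m S := by
  classical
  let f : ι ⊕ ι → Fin m → ℤ := Sum.elim (fun i j => a i j) (fun i j => - a i j)
  have hsum : ∀ z : Multiset (ι ⊕ ι), (z.map f).sum = 0 ↔
      toricDegree a (fun i => z.count (Sum.inl i)) =
        toricDegree a (fun i => z.count (Sum.inr i)) := by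
    intro z
    have h1 : (z.map f).sum = ∑ x, z.count x • f x := by
      rw [Finset.sum_multiset_map_count]
      exact Finset.sum_subset (Finset.subset_univ _) fun x _ hx => by
        rw [Multiset.count_eq_zero_of_notMem (by simpa using hx), zero_smul]
    rw [h1, funext_iff, funext_iff]
    refine forall_congr' fun j => ?_
    have h2 : (∑ x, z.count x • f x) j = ∑ i, (z.count (Sum.inl i) : ℤ) * a i j -
        ∑ i, (z.count (Sum.inr i) : ℤ) * a i j := by
      simp [Finset.sum_apply, Fintype.sum_sum_type, f, sub_eq_add_neg]
    rw [h2, Pi.zero_apply, sub_eq_zero]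
    exact_mod_cast Iff.rfl
  let z : Multiset (ι ⊕ ι) := ∑ x, Sum.elim u v x • {x}
  have hz : ∀ x, z.count x = Sum.elim u v x := by
    intro x
    rcases x with i | i <;> simp [z, Multiset.count_sum', Multiset.count_singleton]
  obtain ⟨y, hyz, hy0, hys, hyb⟩ := Multiset.exists_zeroSum_card_le (S := S) f z
    (fun x _ j => by
      rcases x with i | i
      · simpa [f] using ha i j
      · simpa [f] using ha i j)
    (by
      obtain ⟨i, hi⟩ := Function.ne_iff.1 hu
      intro h
      have := hz (Sum.inl i)
      simp [h] at this
      exact hi this.symm)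
    ((hsum z).2 (by simpa [hz] using huv))
  refine ⟨fun i => y.count (Sum.inl i), fun i => ?_, fun i => y.count (Sum.inr i), fun i => ?_, ?_,
    (hsum y).1 hys, fun i => (Multiset.count_le_card _ _).trans hyb⟩
  · simpa [hz] using Multiset.count_le_of_le (Sum.inl i) hyz
  · simpa [hz] using Multiset.count_le_of_le (Sum.inr i) hyz
  · obtain ⟨x, hx⟩ := Multiset.exists_mem_of_ne_zero hy0
    rw [← Multiset.count_pos] at hx
    rcases x with i | i
    · exact Or.inl (Function.ne_iff.2 ⟨i, hx.ne'⟩)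
    · exact Or.inr (Function.ne_iff.2 ⟨i, hx.ne'⟩)

/-! ### Fibers of the degree map -/

theorem pi_single_one_le {ι : Type*} [DecidableEq ι] {u : ι → ℕ} {i : ι} (h : u i ≠ 0) :
    Pi.single i 1 ≤ u := by
  intro j
  rcases eq_or_ne j i with rfl | hj
  · simpa [Nat.one_le_iff_ne_zero] using h
  · simp [hj]

section ReducedExponents

variable {ι : Type} {m : ℕ} (a : ι → Fin m → ℕ)

/-- The exponent `u` does not involve the variables of degree zero. -/
def IsReducedExp (u : ι → ℕ) : Prop := ∀ i, a i = 0 → u i = 0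

/-- Removes the variables of degree zero. -/
def reduceExp (u : ι → ℕ) (i : ι) : ℕ := if a i = 0 then 0 else u i

theorem isReducedExp_reduceExp (u : ι → ℕ) : IsReducedExp a (reduceExp a u) := fun i hi => by
  simp [reduceExp, hi]

variable {a} {u v : ι → ℕ}

theorem IsReducedExp.mono (hv : IsReducedExp a v) (h : u ≤ v) : IsReducedExp a u := fun i hi =>
  Nat.le_zero.1 ((h i).trans (hv i hi).le)

theorem IsReducedExp.add (hu : IsReducedExp a u) (hv : IsReducedExp a v) :
    IsReducedExp a (u + v) := fun i hi => by simp [hu i hi, hv i hi]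

theorem reduceExp_add (u v : ι → ℕ) : reduceExp a (u + v) = reduceExp a u + reduceExp a v := by
  ext i
  by_cases hi : a i = 0 <;> simp [reduceExp, hi]

theorem IsReducedExp.reduceExp_eq {u : ι → ℕ} (hu : IsReducedExp a u) : reduceExp a u = u := by
  ext i
  by_cases hi : a i = 0 <;> simp [reduceExp, hi, hu i]

end ReducedExponents

section ToricFibers

variable {ι : Type} [Fintype ι] {m : ℕ} (a : ι → Fin m → ℕ)

theorem toricDegree_add (u v : ι → ℕ) :
    toricDegree a (u + v) = toricDegree a u + toricDegree a v := by
  ext j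
  simp [toricDegree, add_mul, Finset.sum_add_distrib]

theorem toricDegree_zero : toricDegree a 0 = 0 := by
  ext j
  simp [toricDegree]

theorem toricDegree_reduceExp (u : ι → ℕ) : toricDegree a (reduceExp a u) = toricDegree a u := by
  ext j
  refine Finset.sum_congr rfl fun i _ => ?_
  by_cases hi : a i = 0 <;> simp [reduceExp, hi]

/-- The reduced exponent `v` has the same degree as `u`. -/
def InFiber (u v : ι → ℕ) : Prop := IsReducedExp a v ∧ toricDegree a v = toricDegree a u

/-- In the fiber of `u`, each exponent is supported either in `σ` or in its complement. -/
def SplitsFiber (u : ι → ℕ) (σ : Finset ι) : Prop :=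
  ∀ w, InFiber a u w → (∀ i, w i ≠ 0 → i ∈ σ) ∨ ∀ i, w i ≠ 0 → i ∉ σ

/-- The exponents `u` and `v` are not separated by a splitting of the fiber of `u`. -/
def LinkedExp (u v : ι → ℕ) : Prop :=
  ∀ σ, SplitsFiber a u σ → ((∀ i, u i ≠ 0 → i ∈ σ) ↔ ∀ i, v i ≠ 0 → i ∈ σ)

/-- The lexicographically minimal exponents of the linkage classes that are not minimal in their
fibers. -/
def extraClassReps [LinearOrder ι] : Set (ι → ℕ) :=
  {u | IsReducedExp a u ∧ (∀ v, InFiber a u v → LinkedExp a u v → toLex u ≤ toLex v) ∧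
    ∃ v, InFiber a u v ∧ toLex v < toLex u}

variable {a} {u v w : ι → ℕ}

theorem IsReducedExp.eq_zero (hu : IsReducedExp a u) (h : toricDegree a u = 0) : u = 0 := by
  ext i
  by_cases hi : a i = 0
  · exact hu i hi
  · obtain ⟨j, hj⟩ := Function.ne_iff.1 hi
    have := congrFun h j
    simp only [toricDegree, Pi.zero_apply, Finset.sum_eq_zero_iff, Finset.mem_univ, true_imp_iff,
      mul_eq_zero] at this
    exact (this i).resolve_right hj

theorem InFiber.trans (h : InFiber a u v) (h' : InFiber a v w) : InFiber a u w :=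
  ⟨h'.1, h'.2.trans h.2⟩

theorem InFiber.symm (hu : IsReducedExp a u) (h : InFiber a u v) : InFiber a v u := ⟨hu, h.2.symm⟩

theorem SplitsFiber.congr {σ : Finset ι} (h : toricDegree a u = toricDegree a v)
    (hσ : SplitsFiber a u σ) : SplitsFiber a v σ := fun w hw => hσ w ⟨hw.1, hw.2.trans h.symm⟩

theorem LinkedExp.trans (h : toricDegree a v = toricDegree a u) (huv : LinkedExp a u v)
    (hvw : LinkedExp a v w) : LinkedExp a u w := fun σ hσ =>
  (huv σ hσ).trans (hvw σ (hσ.congr h.symm))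

theorem LinkedExp.symm (h : toricDegree a v = toricDegree a u) (huv : LinkedExp a u v) :
    LinkedExp a v u := fun σ hσ => (huv σ (hσ.congr h)).symm

theorem LinkedExp.refl (u : ι → ℕ) : LinkedExp a u u := fun _ _ => Iff.rfl

theorem InFiber.linkedExp (hu : IsReducedExp a u) (h : InFiber a u v) {i : ι} (hui : u i ≠ 0)
    (hvi : v i ≠ 0) : LinkedExp a u v := by
  intro σ hσ
  have h1 := hσ u ⟨hu, rfl⟩
  have h2 := hσ v h
  constructor
  · intro h'
    exact h2.resolve_right fun h3 => h3 i hvi (h' i hui)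
  · intro h'
    exact h1.resolve_right fun h3 => h3 i hui (h' i hvi)

theorem le_zeroSumBound_of_mem_extraClassReps [LinearOrder ι] {S : ℕ} (ha : ∀ i j, a i j ≤ S)
    (hu : u ∈ extraClassReps a) (i : ι) : u i ≤ zeroSumBound m S := by
  obtain ⟨hred, hmin, v, hv, hlt⟩ := hu
  have hnl : ¬ LinkedExp a u v := fun h => (hmin v hv h).not_gt hlt
  have hu0 : u ≠ 0 := by
    rintro rfl
    rw [hv.1.eq_zero (hv.2.trans (toricDegree_zero a))] at hlt
    exact lt_irrefl _ hlt
  obtain ⟨u', hu', v', hv', hne, hdeg, hb⟩ := exists_small_relation a ha hv.2.symm hu0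
  have hr' := hred.mono hu'
  have hs' := hv.1.mono hv'
  have hu'0 : u' ≠ 0 := by
    rintro rfl
    exact hne.elim (fun h => h rfl) fun h =>
      h (hs'.eq_zero (hdeg.symm.trans (toricDegree_zero a)))
  obtain ⟨t, rfl⟩ := le_iff_exists_add.1 hv'
  by_cases ht : t = 0
  · subst ht
    obtain ⟨s, rfl⟩ := le_iff_exists_add.1 hu'
    have hs : s = 0 := by
      refine (hred.mono (le_add_of_nonneg_left (zero_le))).eq_zero ?_
      have := hv.2
      rw [add_zero, ← hdeg, toricDegree_add] at this
      exact left_eq_add.1 this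
    simpa [hs] using hb i
  · have ht' : IsReducedExp a t := hv.1.mono (le_add_of_nonneg_left (zero_le))
    have hw : InFiber a u (u' + t) := by
      refine ⟨hr'.add ht', ?_⟩
      rw [← hv.2, toricDegree_add, toricDegree_add, hdeg]
    obtain ⟨i, hi⟩ := Function.ne_iff.1 hu'0
    obtain ⟨j, hj⟩ := Function.ne_iff.1 ht
    simp only [Pi.zero_apply] at hi hj
    have h1 : LinkedExp a u (u' + t) := hw.linkedExp hred
      (fun h => hi (Nat.le_zero.1 (h ▸ hu' i))) (i := i) (by simp [hi])
    have h2 : LinkedExp a (u' + t) (v' + t) := ((hw.symm hred).trans hv).linkedExp hw.1 (i := j)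
      (by simp [hj]) (by simp [hj])
    exact (hnl (h1.trans hw.2 h2)).elim

theorem finite_extraClassReps [LinearOrder ι] (a : ι → Fin m → ℕ) : (extraClassReps a).Finite := by
  obtain ⟨S, hS⟩ : ∃ S, ∀ i j, a i j ≤ S :=
    ⟨∑ i, ∑ j, a i j, fun i j => (Finset.single_le_sum (f := a i) (fun _ _ => zero_le)
      (Finset.mem_univ j)).trans (Finset.single_le_sum (f := fun i => ∑ j, a i j)
        (fun _ _ => zero_le) (Finset.mem_univ i))⟩
  exact (Set.Finite.pi' fun _ : ι => Set.finite_Iic (zeroSumBound m S)).subset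
    fun u hu i => le_zeroSumBound_of_mem_extraClassReps hS hu i

theorem exists_lex_min [LinearOrder ι] {P : (ι → ℕ) → Prop} (hP : P u) :
    ∃ v, P v ∧ ∀ w, P w → toLex v ≤ toLex w := by
  obtain ⟨v, hv, hmin⟩ := WellFounded.has_min (wellFounded_lt (α := Lex (ι → ℕ)))
    {x | P (ofLex x)} ⟨toLex u, hP⟩
  exact ⟨ofLex v, hv, fun w hw => not_lt.1 (hmin (toLex w) hw)⟩

/-- Exponents of the same degree have the same value under an evaluation that respects the
relations coming from `extraClassReps a` and from the variables of degree zero. -/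
theorem prod_pow_eq_of_toricDegree_eq [LinearOrder ι] {Q : Type*} [CommMonoid Q] (x : ι → Q)
    (hx : ∀ i, a i = 0 → x i = 1)
    (hr : ∀ r ∈ extraClassReps a, ∀ v, InFiber a r v →
      (∀ w, InFiber a r w → toLex v ≤ toLex w) → ∏ i, x i ^ r i = ∏ i, x i ^ v i)
    (h : toricDegree a u = toricDegree a v) : ∏ i, x i ^ u i = ∏ i, x i ^ v i := by
  classical
  let q : (ι → ℕ) → Q := fun u => ∏ i, x i ^ u i
  have hadd : ∀ u v, q (u + v) = q u * q v := fun u v => by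
    simp [q, pow_add, Finset.prod_mul_distrib]
  have main : ∀ N u v, ∑ j, toricDegree a u j = N → IsReducedExp a u → InFiber a u v →
      q u = q v := by
    intro N
    induction N using Nat.strong_induction_on with
    | _ N ih =>
      have hshare : ∀ u v i, ∑ j, toricDegree a u j = N → IsReducedExp a u → InFiber a u v →
          u i ≠ 0 → v i ≠ 0 → q u = q v := by
        intro u v i hN hu hv hui hvi
        obtain ⟨u', rfl⟩ := le_iff_exists_add.1 (pi_single_one_le hui)
        obtain ⟨v', rfl⟩ := le_iff_exists_add.1 (pi_single_one_le hvi)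
        have hai : a i ≠ 0 := fun h => hui (hu i h)
        have hdi : toricDegree a (Pi.single i 1) = a i := by
          ext j
          simp [toricDegree, Pi.single_apply]
        have hlt : ∑ j, toricDegree a u' j < N := by
          obtain ⟨j, hj⟩ := Function.ne_iff.1 hai
          have : 0 < ∑ j, a i j := Finset.sum_pos' (fun _ _ => zero_le)
            ⟨j, Finset.mem_univ j, Nat.pos_of_ne_zero hj⟩
          rw [toricDegree_add, hdi] at hN
          simp only [Pi.add_apply, Finset.sum_add_distrib] at hN
          omega
        have hv2 := hv.2
        rw [toricDegree_add, toricDegree_add] at hv2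
        rw [hadd, hadd, ih _ hlt u' v' rfl (hu.mono (le_add_of_nonneg_left (zero_le)))
          ⟨hv.1.mono (le_add_of_nonneg_left (zero_le)), add_left_cancel hv2⟩]
      have hlink : ∀ u v, ∑ j, toricDegree a u j = N → IsReducedExp a u → InFiber a u v →
          LinkedExp a u v → q u = q v := by
        intro u v hN hu hv hl
        by_cases hv0 : v = 0
        · subst hv0
          rw [hu.eq_zero (hv.2.symm.trans (toricDegree_zero a))]
        obtain ⟨i, hi⟩ := Function.ne_iff.1 hv0
        let σ : Finset ι := {i | ∃ w, InFiber a u w ∧ q w = q u ∧ w i ≠ 0}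
        have hσ : ∀ i, i ∈ σ ↔ ∃ w, InFiber a u w ∧ q w = q u ∧ w i ≠ 0 := by simp [σ]
        have hmem : ∀ w i, InFiber a u w → w i ≠ 0 → i ∈ σ → q w = q u := by
          intro w i hw hwi hi
          obtain ⟨w', hw', hq, hwi'⟩ := (hσ i).1 hi
          rw [← hq]
          exact hshare w w' i (by rw [hw.2, hN]) hw.1 ((hw.symm hu).trans hw') hwi hwi'
        have hs : SplitsFiber a u σ := by
          intro w hw
          by_cases hex : ∃ i, w i ≠ 0 ∧ i ∈ σ
          · obtain ⟨i, hwi, hi⟩ := hex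
            exact Or.inl fun j hj => (hσ j).2 ⟨w, hw, hmem w i hw hwi hi, hj⟩
          · push Not at hex
            exact Or.inr hex
        exact (hmem v i hv hi ((hl σ hs).1 (fun j hj => (hσ j).2 ⟨u, ⟨hu, rfl⟩, rfl, hj⟩) i hi)).symm
      intro u v hN hu hv
      obtain ⟨μ, hμ, hmin⟩ := exists_lex_min (P := InFiber a u) (u := u) ⟨hu, rfl⟩
      have key : ∀ w, InFiber a u w → q w = q μ := by
        intro w hw
        obtain ⟨c, ⟨hc, hcl⟩, hcmin⟩ := exists_lex_min (u := w)
          (P := fun c => InFiber a u c ∧ LinkedExp a w c) ⟨hw, .refl _⟩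
        have hwc := (hw.symm hu).trans hc
        rw [hlink w c (by rw [hw.2, hN]) hw.1 hwc hcl]
        rcases (hmin c hc).eq_or_lt with h | h
        · rw [toLex.injective h]
        · refine hr c ⟨hc.1, fun t ht hct => hcmin t ⟨hc.trans ht, hcl.trans hwc.2 hct⟩,
            μ, (hc.symm hu).trans hμ, h⟩ μ ((hc.symm hu).trans hμ) fun t ht => hmin t (hc.trans ht)
      rw [key u ⟨hu, rfl⟩, key v hv]
  have hqr : ∀ u, q u = q (reduceExp a u) := by
    intro u
    refine Finset.prod_congr rfl fun i _ => ?_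
    by_cases hi : a i = 0 <;> simp [reduceExp, hi, hx]
  change q u = q v
  rw [hqr u, hqr v]
  exact main _ _ _ rfl (isReducedExp_reduceExp a u) ⟨isReducedExp_reduceExp a v, by
    rw [toricDegree_reduceExp, toricDegree_reduceExp, h]⟩

end ToricFibers

/-! ### Generators of toric ideals -/

open MvPolynomial in
/-- The monomial map `x i ↦ y ^ a i`. -/
noncomputable abbrev toricMap (K : Type*) [Field K] {ι : Type} {m : ℕ} (a : ι → Fin m → ℕ) :
    MvPolynomial ι K →ₐ[K] MvPolynomial (Fin m) K :=
  aeval fun i => monomial (Finsupp.equivFunOnFinite.symm (a i)) (1 : K)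

section ToricIdeal

variable {K : Type*} [Field K] {ι : Type} [Fintype ι] {m : ℕ} {a : ι → Fin m → ℕ}

open MvPolynomial

theorem toricMap_monomial (u : ι →₀ ℕ) :
    toricMap K a (monomial u 1) =
      monomial (Finsupp.equivFunOnFinite.symm (toricDegree a u)) 1 := by
  rw [aeval_monomial, map_one, one_mul, Finsupp.prod_fintype _ _ (fun i => pow_zero _)]
  simp only [monomial_pow, one_pow]
  rw [← monomial_sum_one]
  have : ∑ i, u i • Finsupp.equivFunOnFinite.symm (a i) =
      Finsupp.equivFunOnFinite.symm (toricDegree a u) := by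
    ext j
    simp [toricDegree, Finsupp.finsetSum_apply]
  rw [this]

/-- A linear map that identifies monomials of the same degree vanishes on the toric ideal. -/
theorem eq_zero_of_toricMap_eq_zero {V : Type*} [AddCommGroup V] [Module K V]
    (ψ : MvPolynomial ι K →ₗ[K] V)
    (hψ : ∀ u v : ι →₀ ℕ, toricDegree a u = toricDegree a v → ψ (monomial u 1) = ψ (monomial v 1))
    {f : MvPolynomial ι K} (hf : toricMap K a f = 0) : ψ f = 0 := by
  classical
  let θ : MvPolynomial (Fin m) K →ₗ[K] V := (basisMonomials (Fin m) K).constr K fun b =>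
    if h : ∃ u : ι →₀ ℕ, toricDegree a u = b then ψ (monomial h.choose 1) else 0
  have hθ : ψ = θ ∘ₗ (toricMap K a).toLinearMap := by
    refine (basisMonomials ι K).ext fun u => ?_
    have h : ∃ u' : ι →₀ ℕ, toricDegree a u' =
        ⇑(Finsupp.equivFunOnFinite.symm (toricDegree a u)) := ⟨u, by simp⟩
    rw [LinearMap.comp_apply, AlgHom.toLinearMap_apply, coe_basisMonomials, toricMap_monomial,
      ← congrFun (coe_basisMonomials (Fin m) K), Module.Basis.constr_basis, dif_pos h]
    exact hψ _ _ (by simpa using h.choose_spec.symm)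
  rw [hθ, LinearMap.comp_apply, AlgHom.toLinearMap_apply, hf, map_zero]

theorem monomial_one_eq_prod (u : ι →₀ ℕ) :
    (monomial u 1 : MvPolynomial ι K) = ∏ i, X i ^ u i := by
  rw [monomial_eq, map_one, one_mul, Finsupp.prod_fintype _ _ (fun i => pow_zero _)]

/-- The monomial with exponent `u`. -/
noncomputable def expMonomial (K : Type*) [Field K] (u : ι → ℕ) : MvPolynomial ι K :=
  monomial (Finsupp.equivFunOnFinite.symm u) 1

theorem expMonomial_sub_mem_ker {u v : ι → ℕ} (h : toricDegree a u = toricDegree a v) :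
    expMonomial K u - expMonomial K v ∈ RingHom.ker (toricMap K a) := by
  rw [RingHom.mem_ker, map_sub, sub_eq_zero, expMonomial, expMonomial, toricMap_monomial,
    toricMap_monomial]
  simp [h]

theorem exists_fiberMin [LinearOrder ι] (a : ι → Fin m → ℕ) (u : ι → ℕ) :
    ∃ v, InFiber a u v ∧ ∀ w, InFiber a u w → toLex v ≤ toLex w :=
  exists_lex_min (u := reduceExp a u) ⟨isReducedExp_reduceExp a u, toricDegree_reduceExp a u⟩

theorem exists_generators [LinearOrder ι] (a : ι → Fin m → ℕ) :
    ∃ G : Finset (MvPolynomial ι K), G.card ≤ (extraClassReps a).ncard + Nat.card {i // a i = 0} ∧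
      Ideal.span (G : Set (MvPolynomial ι K)) = RingHom.ker (toricMap K a) := by
  classical
  choose μ hμ hμmin using exists_fiberMin a
  have hfin := finite_extraClassReps a
  let G : Finset (MvPolynomial ι K) :=
    hfin.toFinset.image (fun r => expMonomial K r - expMonomial K (μ r)) ∪
      (Finset.univ.filter fun i => a i = 0).image (fun i => X i - 1)
  have hGr : ∀ r ∈ extraClassReps a, expMonomial K r - expMonomial K (μ r) ∈ G := fun r hr =>
    Finset.mem_union_left _ (Finset.mem_image_of_mem _ (hfin.mem_toFinset.2 hr))
  have hGz : ∀ i, a i = 0 → (X i - 1 : MvPolynomial ι K) ∈ G := fun i hi =>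
    Finset.mem_union_right _ (Finset.mem_image_of_mem _ (by simp [hi]))
  refine ⟨G, ?_, le_antisymm (Ideal.span_le.2 ?_) ?_⟩
  · refine (Finset.card_union_le _ _).trans (add_le_add ?_ ?_)
    · rw [Set.ncard_eq_toFinset_card _ hfin]
      exact Finset.card_image_le
    · rw [Nat.card_eq_fintype_card, Fintype.card_subtype]
      exact Finset.card_image_le
  · intro g hg
    rcases Finset.mem_union.1 hg with hg | hg
    · obtain ⟨r, -, rfl⟩ := Finset.mem_image.1 hg
      exact expMonomial_sub_mem_ker (hμ r).2.symm
    · obtain ⟨i, hi, rfl⟩ := Finset.mem_image.1 hg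
      rw [Finset.mem_filter] at hi
      have h0 : Finsupp.equivFunOnFinite.symm (0 : Fin m → ℕ) = 0 := by
        ext j
        simp
      rw [SetLike.mem_coe, RingHom.mem_ker, map_sub, toricMap, aeval_X, hi.2, h0]
      simp
  · intro f hf
    let J := Ideal.span (G : Set (MvPolynomial ι K))
    let x : ι → MvPolynomial ι K ⧸ J := fun i => Ideal.Quotient.mk J (X i)
    have hq : ∀ u : ι → ℕ, Ideal.Quotient.mk J (expMonomial K u) = ∏ i, x i ^ u i := by
      intro u
      rw [expMonomial, monomial_one_eq_prod, map_prod]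
      simp [x]
    have hm := eq_zero_of_toricMap_eq_zero (a := a) (Ideal.Quotient.mkₐ K J).toLinearMap
      (fun u v huv => ?_) hf
    · exact Ideal.Quotient.eq_zero_iff_mem.1 hm
    · have := prod_pow_eq_of_toricDegree_eq x (a := a) (fun i hi => ?_) (fun r hr v hv hmin => ?_) huv
      · rw [← hq, ← hq] at this
        simpa [expMonomial] using this
      · have := Ideal.Quotient.eq_zero_iff_mem.2 (Ideal.subset_span (hGz i hi) : X i - 1 ∈ J)
        rwa [map_sub, map_one, sub_eq_zero] at this
      · have hvμ : v = μ r := toLex.injective (le_antisymm (hmin _ (hμ r)) (hμmin r v hv))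
        rw [hvμ, ← hq, ← hq]
        have := Ideal.Quotient.eq_zero_iff_mem.2 (Ideal.subset_span (hGr r hr) : _ ∈ J)
        rwa [map_sub, sub_eq_zero] at this

open Classical in
/-- The coordinates of a monomial modulo the product of the toric ideal with the maximal ideal at
the point whose nonzero coordinates are those of degree zero. -/
noncomputable def classVector (K : Type*) [Field K] [LinearOrder ι] (a : ι → Fin m → ℕ)
    (u : ι → ℕ) : extraClassReps a ⊕ {i // a i = 0} → K :=
  Sum.elim
    (fun r => if toricDegree a u = toricDegree a r ∧ LinkedExp a r (reduceExp a u) then 1 else 0)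
    (fun z => if reduceExp a u = 0 then (u z : K) else 0)

theorem reduceExp_eq_zero_iff {u : ι → ℕ} : reduceExp a u = 0 ↔ toricDegree a u = 0 := by
  rw [← toricDegree_reduceExp a u]
  exact ⟨fun h => by rw [h, toricDegree_zero], fun h => (isReducedExp_reduceExp a u).eq_zero h⟩

theorem classVector_add_sub [LinearOrder ι] {u v : ι → ℕ}
    (h : toricDegree a u = toricDegree a v) (w : ι → ℕ) :
    classVector K a (w + u) - classVector K a (w + v) =
      if reduceExp a w = 0 then classVector K a u - classVector K a v else 0 := by
  classical
  have hd : toricDegree a (w + u) = toricDegree a (w + v) := by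
    rw [toricDegree_add, toricDegree_add, h]
  have huv : reduceExp a u = 0 ↔ reduceExp a v = 0 := by
    rw [reduceExp_eq_zero_iff, reduceExp_eq_zero_iff, h]
  by_cases hw : reduceExp a w = 0
  · have hw' : toricDegree a w = 0 := reduceExp_eq_zero_iff.1 hw
    rw [if_pos hw]
    ext (r | z)
    · simp only [classVector, Pi.sub_apply, Sum.elim_inl, reduceExp_add, toricDegree_add, hw, hw',
        zero_add]
    · simp only [classVector, Pi.sub_apply, Sum.elim_inr, reduceExp_add, hw, zero_add, huv]
      split_ifs <;> simp
  · rw [if_neg hw]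
    ext (r | z)
    · simp only [classVector, Pi.sub_apply, Sum.elim_inl, Pi.zero_apply, sub_eq_zero, hd]
      congr 1
      simp only [eq_iff_iff, and_congr_right_iff]
      intro hr
      obtain ⟨i, hi⟩ := Function.ne_iff.1 hw
      have hfib : InFiber a (reduceExp a (w + u)) (reduceExp a (w + v)) :=
        ⟨isReducedExp_reduceExp _ _, by rw [toricDegree_reduceExp, toricDegree_reduceExp, hd]⟩
      have hl := hfib.linkedExp (isReducedExp_reduceExp _ _) (i := i)
        (by rw [reduceExp_add]; simp at hi; simp [hi]) (by rw [reduceExp_add]; simp at hi; simp [hi])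
      have hd' : toricDegree a (reduceExp a (w + u)) = toricDegree a r := by
        rw [toricDegree_reduceExp, hd, hr]
      exact ⟨fun h => h.trans hd' hl, fun h => h.trans (hfib.2.trans hd') (hl.symm hfib.2)⟩
    · have h1 : ∀ t, reduceExp a (w + t) ≠ 0 := by
        intro t ht
        obtain ⟨i, hi⟩ := Function.ne_iff.1 hw
        have := congrFun ht i
        rw [reduceExp_add] at this
        simp at this hi
        exact hi this.1
      simp [classVector, h1]

theorem classVector_extraClassRep [LinearOrder ι] (r : extraClassReps a) {μ : ι → ℕ}
    (hμ : InFiber a r μ) (hmin : ∀ w, InFiber a r w → toLex μ ≤ toLex w) :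
    classVector K a r - classVector K a μ = Pi.single (Sum.inl r) 1 := by
  classical
  obtain ⟨r, hr⟩ := r
  have hr' := hr
  obtain ⟨hred, hcl, v, hv, hlt⟩ := hr
  dsimp only at *
  have hμr : toLex μ < toLex r := (hmin v hv).trans_lt hlt
  have h0 : toricDegree a r ≠ 0 := by
    intro h
    rw [hred.eq_zero h, hμ.1.eq_zero (hμ.2.trans h)] at hμr
    exact lt_irrefl _ hμr
  ext (⟨s, hs⟩ | z)
  · simp only [classVector, Pi.sub_apply, Sum.elim_inl, hred.reduceExp_eq, hμ.1.reduceExp_eq, hμ.2]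
    obtain ⟨hsred, hscl, t, ht, htlt⟩ := hs
    have h2 : ¬ (toricDegree a r = toricDegree a s ∧ LinkedExp a s μ) := by
      rintro ⟨hd, hl⟩
      have h3 := hscl μ ⟨hμ.1, hμ.2.trans hd⟩ hl
      exact (h3.trans (hmin t ⟨ht.1, ht.2.trans hd.symm⟩)).not_gt htlt
    rw [if_neg h2, sub_zero]
    by_cases hrs : s = r
    · subst hrs
      simp [LinkedExp.refl]
    · rw [if_neg, Pi.single_eq_of_ne]
      · exact fun h => hrs (congrArg Subtype.val (Sum.inl.inj h))
      · rintro ⟨hd, hl⟩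
        exact hrs (toLex.injective (le_antisymm (hscl r ⟨hred, hd⟩ hl)
          (hcl s ⟨hsred, hd.symm⟩ (hl.symm hd))))
  · have h1 : reduceExp a r ≠ 0 := fun h => h0 (reduceExp_eq_zero_iff.1 h)
    have h2 : reduceExp a μ ≠ 0 := fun h => h0 (hμ.2.symm.trans (reduceExp_eq_zero_iff.1 h))
    simp [classVector, h1, h2]

theorem classVector_single [LinearOrder ι] (z : {i // a i = 0}) :
    classVector K a (Pi.single z.1 1) - classVector K a 0 = Pi.single (Sum.inr z) 1 := by
  classical
  have hz : reduceExp a (Pi.single z.1 1) = 0 := by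
    ext i
    by_cases hi : a i = 0
    · simp [reduceExp, hi]
    · have : i ≠ z.1 := fun h => hi (h ▸ z.2)
      simp [reduceExp, this]
  have h0 : reduceExp a 0 = 0 := reduceExp_eq_zero_iff.2 (toricDegree_zero a)
  have hdz := reduceExp_eq_zero_iff.1 hz
  ext (r | i)
  · simp [classVector, hz, h0, hdz, toricDegree_zero]
  · simp only [classVector, Pi.sub_apply, Sum.elim_inr, hz, h0, if_true, Pi.zero_apply,
      Nat.cast_zero, sub_zero]
    by_cases hi : i = z
    · subst hi
      simp
    · have : i.1 ≠ z.1 := fun h => hi (Subtype.ext h)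
      simp [hi, this]

theorem card_le_of_span_eq_ker [LinearOrder ι] (G : Finset (MvPolynomial ι K))
    (hG : Ideal.span (G : Set (MvPolynomial ι K)) = RingHom.ker (toricMap K a)) :
    (extraClassReps a).ncard + Nat.card {i // a i = 0} ≤ G.card := by
  classical
  have := (finite_extraClassReps a).fintype
  let φ : MvPolynomial ι K →ₗ[K] (extraClassReps a ⊕ {i // a i = 0} → K) :=
    (basisMonomials ι K).constr K fun u => classVector K a u
  have hφ : ∀ u : ι →₀ ℕ, φ (monomial u 1) = classVector K a u := fun u => by
    rw [← congrFun (coe_basisMonomials ι K), Module.Basis.constr_basis]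
  have hφe : ∀ u : ι → ℕ, φ (expMonomial K u) = classVector K a u := fun u => by
    rw [expMonomial, hφ]
    simp
  let W := Submodule.span K (φ '' (G : Set (MvPolynomial ι K)))
  have hmono : ∀ (w : ι →₀ ℕ) f, toricMap K a f = 0 →
      φ (monomial w 1 * f) = if reduceExp a w = 0 then φ f else 0 := by
    intro w f hf
    let ψ : MvPolynomial ι K →ₗ[K] (extraClassReps a ⊕ {i // a i = 0} → K) :=
      φ ∘ₗ LinearMap.mulLeft K (monomial w 1) - if reduceExp a w = 0 then φ else 0
    have hψ : ψ f = 0 := by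
      refine eq_zero_of_toricMap_eq_zero (a := a) ψ (fun u v huv => ?_) hf
      have hc := classVector_add_sub (K := K) huv w
      have hm : ∀ t : ι →₀ ℕ, φ (monomial w 1 * monomial t 1) = classVector K a (w + t : ι → ℕ) := by
        intro t
        rw [monomial_mul, mul_one, hφ, Finsupp.coe_add]
      by_cases hw : reduceExp a w = 0
      · simp only [hw, if_true] at hc
        simp only [ψ, hw, if_true, LinearMap.sub_apply, LinearMap.comp_apply,
          LinearMap.mulLeft_apply, hm, hφ]
        rw [sub_eq_sub_iff_sub_eq_sub, hc]
      · simp only [hw, if_false] at hc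
        simpa only [ψ, hw, if_false, LinearMap.sub_apply, LinearMap.comp_apply,
          LinearMap.mulLeft_apply, hm, hφ, LinearMap.zero_apply, sub_zero, sub_eq_zero] using hc
    by_cases hw : reduceExp a w = 0 <;>
      simpa [ψ, hw, sub_eq_zero] using hψ
  have hmul : ∀ h f, toricMap K a f = 0 → φ f ∈ W → φ (h * f) ∈ W := by
    intro h f hf hfW
    induction h using MvPolynomial.induction_on' with
    | monomial w c =>
      have : (monomial w c : MvPolynomial ι K) = c • monomial w 1 := by
        rw [smul_monomial, smul_eq_mul, mul_one]
      rw [this, smul_mul_assoc, map_smul, hmono w f hf]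
      refine W.smul_mem _ ?_
      split_ifs
      · exact hfW
      · exact W.zero_mem
    | add p q hp hq =>
      rw [add_mul, map_add]
      exact W.add_mem hp hq
  have hker : ∀ f ∈ RingHom.ker (toricMap K a), φ f ∈ W := by
    intro f hf
    rw [← hG] at hf
    suffices toricMap K a f = 0 ∧ φ f ∈ W from this.2
    induction hf using Submodule.span_induction with
    | mem g hg =>
      have : g ∈ RingHom.ker (toricMap K a) := hG ▸ Ideal.subset_span hg
      exact ⟨this, Submodule.subset_span ⟨g, hg, rfl⟩⟩
    | zero => exact ⟨map_zero _, by rw [map_zero]; exact W.zero_mem⟩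
    | add f g _ _ hf hg =>
      exact ⟨by rw [map_add, hf.1, hg.1, add_zero], by rw [map_add]; exact W.add_mem hf.2 hg.2⟩
    | smul h f _ hf =>
      exact ⟨by rw [smul_eq_mul, map_mul, hf.1, mul_zero], hmul h f hf.1 hf.2⟩
  have hbasis : ∀ s, Pi.single s (1 : K) ∈ W := by
    rintro (r | z)
    · obtain ⟨μ, hμ, hmin⟩ := exists_fiberMin a r
      rw [← classVector_extraClassRep r hμ hmin, ← hφe, ← hφe, ← map_sub]
      exact hker _ (expMonomial_sub_mem_ker hμ.2.symm)
    · rw [← classVector_single, ← hφe, ← hφe, ← map_sub]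
      refine hker _ (expMonomial_sub_mem_ker ?_)
      rw [toricDegree_zero]
      ext j
      simp [toricDegree, Pi.single_apply, z.2]
  have htop : W = ⊤ := by
    rw [eq_top_iff, ← (Pi.basisFun K _).span_eq, Submodule.span_le]
    rintro _ ⟨s, rfl⟩
    rw [Pi.basisFun_apply]
    exact hbasis s
  have hcard : Module.finrank K W ≤ (G.image φ).card := by
    have := finrank_span_finset_le_card (R := K) (G.image φ)
    rwa [Finset.coe_image] at this
  rw [htop, finrank_top, Module.finrank_fintype_fun_eq_card, Fintype.card_sum] at hcard
  rw [← Nat.card_coe_set_eq, Nat.card_eq_fintype_card, Nat.card_eq_fintype_card]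
  exact hcard.trans Finset.card_image_le

theorem sInf_card_generators [LinearOrder ι] (a : ι → Fin m → ℕ) :
    sInf {r : ℕ | ∃ G : Finset (MvPolynomial ι K), G.card = r ∧
      Ideal.span (G : Set (MvPolynomial ι K)) = RingHom.ker (toricMap K a)} =
      (extraClassReps a).ncard + Nat.card {i // a i = 0} := by
  obtain ⟨G, hGc, hG⟩ := exists_generators (K := K) a
  have hmem : G.card ∈ {r : ℕ | ∃ G : Finset (MvPolynomial ι K), G.card = r ∧
      Ideal.span (G : Set (MvPolynomial ι K)) = RingHom.ker (toricMap K a)} := ⟨G, rfl, hG⟩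
  refine le_antisymm ((Nat.sInf_le hmem).trans hGc) (le_csInf ⟨_, hmem⟩ ?_)
  rintro _ ⟨G, rfl, hG⟩
  exact card_le_of_span_eq_ker G hG

end ToricIdeal

/-! ### Polynomial families of exponents -/

namespace DigitDefinable

section Atoms

variable {ι κ : Type} [Fintype ι] {D : ℕ}

theorem forall_lt [Fintype κ] {P : ℕ → (ι ⊕ κ → ℕ) → Prop} (hP : DigitDefinable D P) :
    DigitDefinable D (fun n u => ∀ v : κ → ℕ, (∀ j, v j < n ^ D) → P n (Sum.elim u v)) :=
  hP.not.exists_lt.not.congr fun n u _ => by push Not; rfl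

theorem le_pow (e : ℕ) (i : ι) : DigitDefinable D (fun n (u : ι → ℕ) => u i ≤ n ^ e) := by
  classical
  refine (nonneg (D := D) (Polynomial.X ^ e) (Pi.single i (-1))).congr fun n u _ => ?_
  have : ∑ j, ((Pi.single i (-1) : ι → Polynomial ℤ) j).eval (n : ℤ) * (u j : ℤ) = -u i := by
    rw [Finset.sum_eq_single i (fun j _ hj => by simp [hj]) (by simp)]
    simp
  rw [this]
  simp only [Polynomial.eval_pow, Polynomial.eval_X]
  zify
  constructor <;> intro h <;> linarith

theorem le (i j : ι) : DigitDefinable D (fun _ (u : ι → ℕ) => u i ≤ u j) := by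
  classical
  refine (nonneg (D := D) 0 (Pi.single j 1 - Pi.single i 1)).congr fun n u _ => ?_
  have : ∑ l, ((Pi.single j 1 - Pi.single i 1 : ι → Polynomial ℤ) l).eval (n : ℤ) * (u l : ℤ) =
      u j - u i := by
    simp only [Pi.sub_apply, Polynomial.eval_sub, sub_mul, Finset.sum_sub_distrib]
    rw [Finset.sum_eq_single j (fun l _ hl => by simp [hl]) (by simp),
      Finset.sum_eq_single i (fun l _ hl => by simp [hl]) (by simp)]
    simp
  rw [this]
  simp

theorem eq_zero (i : ι) : DigitDefinable D (fun _ (u : ι → ℕ) => u i = 0) := by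
  classical
  refine (nonneg (D := D) 0 (Pi.single i (-1))).congr fun n u _ => ?_
  have : ∑ j, ((Pi.single i (-1) : ι → Polynomial ℤ) j).eval (n : ℤ) * (u j : ℤ) = -u i := by
    rw [Finset.sum_eq_single i (fun j _ hj => by simp [hj]) (by simp)]
    simp
  rw [this]
  simp

theorem toLex_lt [LinearOrder ι] :
    DigitDefinable D (fun _ (x : ι ⊕ ι → ℕ) => toLex (x ∘ Sum.inr) < toLex (x ∘ Sum.inl)) := by
  have h : DigitDefinable D (fun _ (x : ι ⊕ ι → ℕ) => ∃ i : ι,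
      (∀ j : ι, j < i → x (.inr j) ≤ x (.inl j) ∧ x (.inl j) ≤ x (.inr j)) ∧
        ¬ x (.inl i) ≤ x (.inr i)) :=
    ex fun i => (all fun j => (const _).imp ((le _ _).and (le _ _))).and (le _ _).not
  refine h.congr fun n x _ => ?_
  simp only [← le_antisymm_iff, not_le]
  rfl

theorem support_subset (σ : Finset ι) :
    DigitDefinable D (fun _ (u : ι → ℕ) => ∀ i, u i ≠ 0 → i ∈ σ) :=
  all fun i => (eq_zero i).not.imp (const _)

theorem support_disjoint (σ : Finset ι) :
    DigitDefinable D (fun _ (u : ι → ℕ) => ∀ i, u i ≠ 0 → i ∉ σ) :=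
  all fun i => (eq_zero i).not.imp (const _)

end Atoms

section PolynomialFamily

variable {ι : Type} [Fintype ι] {D m : ℕ} {a : ℕ → ι → Fin m → ℕ}
  {p : ι → Fin m → Polynomial ℤ}

theorem isReducedExp (ha : ∀ n i j, (a n i j : ℤ) = (p i j).eval (n : ℤ)) :
    DigitDefinable D (fun n u => IsReducedExp (a n) u) := by
  have h : DigitDefinable D (fun n (u : ι → ℕ) => ∀ i, (∀ j, 0 ≤ (-p i j).eval (n : ℤ) +
      ∑ l, (0 : Polynomial ℤ).eval (n : ℤ) * u l) → u i = 0) :=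
    all fun i => (all fun j => nonneg _ _).imp (eq_zero i)
  refine h.congr fun n u _ => forall_congr' fun i => imp_congr_left ?_
  simp only [funext_iff, Polynomial.eval_neg, ← ha, Polynomial.eval_zero, zero_mul,
    Finset.sum_const_zero, add_zero, Pi.zero_apply]
  exact forall_congr' fun j => by omega

theorem inFiber (ha : ∀ n i j, (a n i j : ℤ) = (p i j).eval (n : ℤ)) :
    DigitDefinable D (fun n (x : ι ⊕ ι → ℕ) => InFiber (a n) (x ∘ Sum.inl) (x ∘ Sum.inr)) := by
  refine ((isReducedExp ha).reindex Sum.inr).and ?_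
  have h : DigitDefinable D (fun n (x : ι ⊕ ι → ℕ) => ∀ j,
      0 ≤ (0 : Polynomial ℤ).eval (n : ℤ) +
        ∑ l, (Sum.elim (fun i => p i j) (fun i => -p i j) l).eval (n : ℤ) * x l ∧
      0 ≤ (0 : Polynomial ℤ).eval (n : ℤ) +
        ∑ l, (Sum.elim (fun i => -p i j) (fun i => p i j) l).eval (n : ℤ) * x l) :=
    all fun j => (nonneg _ _).and (nonneg _ _)
  refine h.congr fun n x _ => ?_
  rw [funext_iff]
  refine forall_congr' fun j => ?_
  simp only [Fintype.sum_sum_type, Sum.elim_inl, Sum.elim_inr, Polynomial.eval_neg, ← ha,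
    Polynomial.eval_zero, zero_add, neg_mul, Finset.sum_neg_distrib]
  zify [toricDegree]
  simp only [Function.comp_apply, mul_comm (x _ : ℤ)]
  constructor
  · intro h
    constructor <;> linarith
  · rintro ⟨h₁, h₂⟩
    linarith

theorem splitsFiber (ha : ∀ n i j, (a n i j : ℤ) = (p i j).eval (n : ℤ)) (σ : Finset ι) :
    DigitDefinable D (fun n (u : ι → ℕ) => ∀ w : ι → ℕ, (∀ i, w i < n ^ D) → InFiber (a n) u w →
      (∀ i, w i ≠ 0 → i ∈ σ) ∨ ∀ i, w i ≠ 0 → i ∉ σ) :=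
  ((inFiber ha).imp (((support_subset σ).reindex Sum.inr).or
    ((support_disjoint σ).reindex Sum.inr))).forall_lt

/-- Membership in `extraClassReps`, where all exponents involved are bounded, is definable. -/
theorem extraClassReps [LinearOrder ι] (ha : ∀ n i j, (a n i j : ℤ) = (p i j).eval (n : ℤ)) :
    DigitDefinable D (fun n (u : ι → ℕ) => IsReducedExp (a n) u ∧
      (∀ v : ι → ℕ, (∀ i, v i < n ^ D) → InFiber (a n) u v →
        (∀ σ : Finset ι, (∀ w : ι → ℕ, (∀ i, w i < n ^ D) → InFiber (a n) u w →
          (∀ i, w i ≠ 0 → i ∈ σ) ∨ ∀ i, w i ≠ 0 → i ∉ σ) →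
            ((∀ i, u i ≠ 0 → i ∈ σ) ↔ ∀ i, v i ≠ 0 → i ∈ σ)) → ¬ toLex v < toLex u) ∧
      ∃ v : ι → ℕ, (∀ i, v i < n ^ D) ∧ InFiber (a n) u v ∧ toLex v < toLex u) := by
  refine (isReducedExp ha).and (.and ?_ ((inFiber ha).and toLex_lt).exists_lt)
  exact ((inFiber ha).imp ((all fun σ => ((splitsFiber ha σ).reindex Sum.inl).imp
    (((support_subset σ).reindex Sum.inl).iff ((support_subset σ).reindex Sum.inr))).imp
      toLex_lt.not)).forall_lt

end PolynomialFamily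

end DigitDefinable

theorem InFiber.le_of_le {ι : Type} [Fintype ι] {m : ℕ} {a : ι → Fin m → ℕ} {u v : ι → ℕ}
    {A B : ℕ} (hv : InFiber a u v) (ha : ∀ i j, a i j ≤ A) (hu : ∀ i, u i ≤ B) (i : ι) :
    v i ≤ Fintype.card ι * (B * A) := by
  by_cases hi : a i = 0
  · simp [hv.1 i hi]
  obtain ⟨j, hj⟩ := Function.ne_iff.1 hi
  calc v i ≤ v i * a i j := Nat.le_mul_of_pos_right _ (Nat.pos_of_ne_zero hj)
    _ ≤ toricDegree a v j :=
      Finset.single_le_sum (f := fun i => v i * a i j) (fun _ _ => Nat.zero_le _)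
        (Finset.mem_univ i)
    _ = ∑ i, u i * a i j := congrFun hv.2 j
    _ ≤ ∑ _i : ι, B * A := Finset.sum_le_sum fun i _ => Nat.mul_le_mul (hu i) (ha i j)
    _ = Fintype.card ι * (B * A) := by simp

theorem mem_extraClassReps_iff_of_lt {ι : Type} [Fintype ι] [LinearOrder ι] {m : ℕ}
    {a : ι → Fin m → ℕ} {u : ι → ℕ} {B : ℕ} (hB : ∀ v, InFiber a u v → ∀ i, v i < B) :
    u ∈ extraClassReps a ↔ IsReducedExp a u ∧
      (∀ v : ι → ℕ, (∀ i, v i < B) → InFiber a u v →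
        (∀ σ : Finset ι, (∀ w : ι → ℕ, (∀ i, w i < B) → InFiber a u w →
          (∀ i, w i ≠ 0 → i ∈ σ) ∨ ∀ i, w i ≠ 0 → i ∉ σ) →
            ((∀ i, u i ≠ 0 → i ∈ σ) ↔ ∀ i, v i ≠ 0 → i ∈ σ)) → ¬ toLex v < toLex u) ∧
      ∃ v : ι → ℕ, (∀ i, v i < B) ∧ InFiber a u v ∧ toLex v < toLex u := by
  have hlink : ∀ v, (∀ σ : Finset ι, (∀ w : ι → ℕ, (∀ i, w i < B) → InFiber a u w →
      (∀ i, w i ≠ 0 → i ∈ σ) ∨ ∀ i, w i ≠ 0 → i ∉ σ) →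
        ((∀ i, u i ≠ 0 → i ∈ σ) ↔ ∀ i, v i ≠ 0 → i ∈ σ)) ↔ LinkedExp a u v := fun v =>
    forall_congr' fun σ => imp_congr_left
      ⟨fun h w hw => h w (hB w hw) hw, fun h w _ hw => h w hw⟩
  simp only [hlink]
  exact and_congr_right fun _ => and_congr
    ⟨fun h v _ hv hl => not_lt.2 (h v hv hl), fun h v hv hl => not_lt.1 (h v (hB v hv) hv hl)⟩
    (exists_congr fun v => ⟨fun h => ⟨hB v h.1, h⟩, fun h => h.2⟩)

theorem Polynomial.exists_eval_le_pow (p : Polynomial ℤ) :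
    ∃ N d : ℕ, ∀ n : ℕ, N ≤ n → p.eval (n : ℤ) ≤ (n : ℤ) ^ d := by
  refine ⟨(∑ i ∈ Finset.range (p.natDegree + 1), |p.coeff i|).toNat + 1, p.natDegree + 1,
    fun n hn => ?_⟩
  have h0 : ∑ i ∈ Finset.range (p.natDegree + 1), |p.coeff i| ≤ n := by omega
  have h1 : (1 : ℤ) ≤ n := by omega
  calc p.eval (n : ℤ) = ∑ i ∈ Finset.range (p.natDegree + 1), p.coeff i * (n : ℤ) ^ i :=
        Polynomial.eval_eq_sum_range _
    _ ≤ ∑ i ∈ Finset.range (p.natDegree + 1), |p.coeff i| * (n : ℤ) ^ p.natDegree := by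
      refine Finset.sum_le_sum fun i hi => mul_le_mul (le_abs_self _)
        (pow_le_pow_right₀ h1 (by simpa [Nat.lt_succ_iff] using hi)) (by positivity) (abs_nonneg _)
    _ ≤ (n : ℤ) ^ (p.natDegree + 1) := by
      rw [← Finset.sum_mul, pow_succ']
      gcongr

theorem Polynomial.exists_eval_ne_zero {p : Polynomial ℤ} (hp : p ≠ 0) :
    ∃ N : ℕ, ∀ n : ℕ, N ≤ n → p.eval (n : ℤ) ≠ 0 := by
  obtain ⟨B, hB⟩ := (p.roots.toFinset : Set ℤ).toFinite.bddAbove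
  refine ⟨B.toNat + 1, fun n hn h => ?_⟩
  have : (n : ℤ) ≤ B := hB (by simpa [hp] using h)
  omega

section PolynomialFamily

open Filter

variable {ι : Type} [Fintype ι] {m : ℕ} {a : ℕ → ι → Fin m → ℕ} {p : ι → Fin m → Polynomial ℤ}

theorem exists_eventually_le_pow (ha : ∀ n i j, (a n i j : ℤ) = (p i j).eval (n : ℤ)) :
    ∃ d : ℕ, ∀ᶠ n in atTop, ∀ i j, a n i j ≤ n ^ d := by
  choose N d h using fun x : ι × Fin m => (p x.1 x.2).exists_eval_le_pow
  refine ⟨Finset.univ.sup d, ?_⟩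
  filter_upwards [eventually_ge_atTop (Finset.univ.sup N), eventually_ge_atTop 1] with n hn h1 i j
  have := h (i, j) n ((Finset.le_sup (Finset.mem_univ _)).trans hn)
  rw [← ha] at this
  exact (by exact_mod_cast this : a n i j ≤ n ^ d (i, j)).trans
    (Nat.pow_le_pow_right h1 (Finset.le_sup (Finset.mem_univ _)))

theorem eventually_eq_zero_iff (ha : ∀ n i j, (a n i j : ℤ) = (p i j).eval (n : ℤ)) :
    ∀ᶠ n in atTop, ∀ i, a n i = 0 ↔ p i = 0 := by
  have h : ∀ᶠ n in atTop, ∀ i j, a n i j = 0 ↔ p i j = 0 := by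
    refine eventually_all.2 fun i => eventually_all.2 fun j => ?_
    by_cases hp : p i j = 0
    · refine .of_forall fun n => ?_
      have := ha n i j
      rw [hp, Polynomial.eval_zero] at this
      simp [hp, Int.natCast_eq_zero.1 this]
    · obtain ⟨N, hN⟩ := Polynomial.exists_eval_ne_zero hp
      filter_upwards [eventually_ge_atTop N] with n hn
      have := hN n hn
      rw [← ha] at this
      simpa [hp] using this
  filter_upwards [h] with n hn i
  simp [funext_iff, hn]

theorem isShiftQuasi_ncard_extraClassReps [LinearOrder ι]
    (ha : ∀ n i j, (a n i j : ℤ) = (p i j).eval (n : ℤ)) :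
    IsShiftQuasi (fun n => ((extraClassReps (a n)).ncard : ℤ)) := by
  obtain ⟨d, hd⟩ := exists_eventually_le_pow ha
  obtain ⟨E, hE⟩ := zeroSumBound_pow_le m d
  obtain ⟨N, hN⟩ := eventually_atTop.1 hd
  have hdef := (DigitDefinable.all (DigitDefinable.le_pow (D := E + d + 1) E)).and
    (DigitDefinable.extraClassReps (D := E + d + 1) ha)
  refine hdef.isShiftQuasi_ncard.congr (N + 3 + Fintype.card ι) fun n hn => ?_
  have hsmall := hN n (by omega)
  have hpow : Fintype.card ι * (n ^ E * n ^ d) < n ^ (E + d + 1) := by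
    have hn0 : 0 < n := by omega
    rw [pow_succ', pow_add]
    exact Nat.mul_lt_mul_of_pos_right (by omega) (by positivity)
  have hfib : ∀ u : ι → ℕ, (∀ i, u i ≤ n ^ E) →
      ∀ v, InFiber (a n) u v → ∀ i, v i < n ^ (E + d + 1) :=
    fun u hu v hv i => (hv.le_of_le hsmall hu i).trans_lt hpow
  congr 2
  ext u
  constructor
  · intro h
    have hu : ∀ i, u i ≤ n ^ E := fun i =>
      (le_zeroSumBound_of_mem_extraClassReps hsmall h i).trans (hE n (by omega))
    exact ⟨hfib u hu u ⟨h.1, rfl⟩, hu, (mem_extraClassReps_iff_of_lt (hfib u hu)).1 h⟩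
  · rintro ⟨-, hu, h⟩
    exact (mem_extraClassReps_iff_of_lt (hfib u hu)).2 h

end PolynomialFamily

theorem stmt19 (K : Type*) [Field K] (k m : ℕ) (hk : 1 ≤ k) (hm : 1 ≤ m)
    (F : Fin k → ℕ → Fin m → ℕ)
    (hF : ∀ i j, ∃ p : Polynomial ℤ, ∀ n : ℕ, ((F i n j : ℤ) = p.eval (n : ℤ))) :
    IsEQP (fun n =>
      ((sInf {r : ℕ | ∃ G : Finset (MvPolynomial (Fin k) K), G.card = r ∧
        Ideal.span (G : Set (MvPolynomial (Fin k) K))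
          = RingHom.ker (MvPolynomial.aeval
              (fun i : Fin k =>
                MvPolynomial.monomial (Finsupp.equivFunOnFinite.symm (F i n)) (1 : K))
              : MvPolynomial (Fin k) K →ₐ[K] MvPolynomial (Fin m) K)} : ℕ) : ℤ)) := by
  choose p hp using hF
  have ha : ∀ n i j, (F i n j : ℤ) = (p i j).eval (n : ℤ) := fun n i j => hp i j n
  obtain ⟨N, hN⟩ := Filter.eventually_atTop.1 (eventually_eq_zero_iff (a := fun n i => F i n) ha)
  refine (((isShiftQuasi_ncard_extraClassReps (a := fun n i => F i n) ha).add
    (.const (Nat.card {i // p i = 0} : ℤ))).congr N fun n hn => ?_).isEQP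
  have := sInf_card_generators (K := K) fun i => F i n
  simp only [hN n hn] at this
  exact_mod_cast this
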